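/- arXiv:2304.03467 — 4 statements merged into one kernel-verified Lean document; each statement's English description precedes it below -/
import Mathlib

section
/- Fix an integer N ≥ 1 and let K be a field. On tuples v = (a0,…,a_{2N}, b, c, q, f1,…,f_{2N}) of nonzero elements of K satisfying a0·a1···a_{2N} = q, define the (partially defined) maps, with indices of the a's read modulo 2N+1: for i = 1,…,2N, s_i replaces a_i by a_i^{−1}, a_{i−1} by a_{i−1}·a_i, a_{i+1} by a_i·a_{i+1}, and, writing μ_i = c^2 if i is odd and μ_i = c^{−2} if i is even, replaces f_{i−1} by f_{i−1}·(μ_i − a_i^{2N+1}·f_i)/(a_i^{2N+1}·μ_i − f_i) when 1 ≤ i−1 and f_{i+1} by f_{i+1}·(a_i^{2N+1}·μ_i − f_i)/(μ_i − a_i^{2N+1}·f_i) when i+1 ≤ 2N, fixing all other components; π(v) = (a1,…,a_{2N}, a0, q·b, c^{−1}, q, f2,…,f_{2N}, Q) where Q = −(c^4/∏_{k=1}^N f_{2k−1})·(∏_{k=1}^N f_{2k} + q^{2N}·a0·b/[(∏_{k=1}^{2N−1} a_k^{2N−k})·c]); w1(v) has j-th a-component 1/a_{2N+1−j} (indices mod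 2N+1), b-component q^{2N+1}·b, c-component c^{−1}, q-component q^{−1}, and j-th f-component f_{2N+1−j}. Then, at every tuple where all the rational expressions arising in the indicated composites are defined and nonzero: (1) s_i∘s_i = id (i = 1,…,2N); (2) s_i∘s_{i+1}∘s_i = s_{i+1}∘s_i∘s_{i+1} (i = 1,…,2N−1); (3) s_i∘s_j = s_j∘s_i whenever 1 ≤ i, j ≤ 2N and |i−j| ≥ 2; (4) w1∘w1 = id; (5) w1∘s_k∘w1 = s_{2N+1−k} (k = 1,…,2N); (6) π∘s_k∘π^{−1} = s_{k−1} (k = 2,…,2N) and π∘π∘s_1∘π^{−1}∘π^{−1} = s_{2N}; (7) (π∘w1)∘(π∘w1) = id; (8) setting s0 = π∘s_1∘π^{−1}, the relations (1), (2), (3) and (5) hold for all indices read modulo 2N+1. -/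
open Finset

namespace WeylA2NA1

/-- A tuple `(a₀, …, a_{2N}, b, c, q, f₁, …, f_{2N})`: the `a`-components are indexed
cyclically by `ZMod (2N+1)` and the `f`-components by the natural numbers `1, …, 2N`
(values of `f` outside this range are junk, untouched by all the maps below). -/
structure Tup (N : ℕ) (K : Type*) where
  a : ZMod (2 * N + 1) → K
  b : K
  c : K
  q : K
  f : ℕ → K

variable {N : ℕ} {K : Type*} [Field K]

/-- All entries of the tuple are nonzero. -/
def Nz (v : Tup N K) : Prop :=
  (∀ j : ZMod (2 * N + 1), v.a j ≠ 0) ∧ v.b ≠ 0 ∧ v.c ≠ 0 ∧ v.q ≠ 0 ∧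
    ∀ j ∈ Icc 1 (2 * N), v.f j ≠ 0

/-- The constraint `a₀·a₁···a_{2N} = q`. -/
def C (v : Tup N K) : Prop := (∏ k ∈ range (2 * N + 1), v.a k) = v.q

/-- `μ_i = c²` if `i` is odd and `μ_i = c⁻²` if `i` is even. -/
def mu (c : K) (i : ℕ) : K := if Odd i then c ^ 2 else (c ^ 2)⁻¹

/-- The map `s_i` (`i = 1, …, 2N`). -/
def sMap (i : ℕ) (v : Tup N K) : Tup N K where
  a := fun j =>
    if j = (i : ZMod (2 * N + 1)) then (v.a j)⁻¹
    else if j = (i : ZMod (2 * N + 1)) + 1 ∨ j = (i : ZMod (2 * N + 1)) - 1 then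
      v.a (i : ZMod (2 * N + 1)) * v.a j
    else v.a j
  b := v.b
  c := v.c
  q := v.q
  f := fun j =>
    if 2 ≤ i ∧ j = i - 1 then
      v.f (i - 1) * (mu v.c i - v.a i ^ (2 * N + 1) * v.f i)
        / (v.a i ^ (2 * N + 1) * mu v.c i - v.f i)
    else if i ≤ 2 * N - 1 ∧ j = i + 1 then
      v.f (i + 1) * (v.a i ^ (2 * N + 1) * mu v.c i - v.f i)
        / (mu v.c i - v.a i ^ (2 * N + 1) * v.f i)
    else v.f j

/-- The last `f`-component of `π`. -/
def Qval (v : Tup N K) : K :=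
  -(v.c ^ 4 / ∏ k ∈ Icc 1 N, v.f (2 * k - 1)) *
    ((∏ k ∈ Icc 1 N, v.f (2 * k)) +
      v.q ^ (2 * N) * v.a 0 * v.b
        / ((∏ k ∈ Icc 1 (2 * N - 1), v.a k ^ (2 * N - k)) * v.c))

/-- The map `π`. -/
def piMap (v : Tup N K) : Tup N K where
  a := fun j => v.a (j + 1)
  b := v.q * v.b
  c := v.c⁻¹
  q := v.q
  f := fun j =>
    if 1 ≤ j ∧ j ≤ 2 * N - 1 then v.f (j + 1) else if j = 2 * N then Qval v else v.f j

/-- The (partial, birational) inverse of `π`. -/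
def piInv (v : Tup N K) : Tup N K where
  a := fun j => v.a (j - 1)
  b := v.b / v.q
  c := v.c⁻¹
  q := v.q
  f := fun j =>
    if j = 1 then
      -(v.c⁻¹ ^ 4 *
          ((∏ k ∈ Icc 1 N, v.f (2 * k - 1)) +
            v.q ^ (2 * N) * v.a (-1) * (v.b / v.q)
              / ((∏ k ∈ Icc 1 (2 * N - 1), v.a ((k : ZMod (2 * N + 1)) - 1) ^ (2 * N - k)) *
                  v.c⁻¹)))
        / ((∏ k ∈ Icc 1 (N - 1), v.f (2 * k)) * v.f (2 * N))
    else if 2 ≤ j ∧ j ≤ 2 * N then v.f (j - 1)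
    else v.f j

/-- The map `w₁`. -/
def w1 (v : Tup N K) : Tup N K where
  a := fun j => (v.a (-j))⁻¹
  b := v.q ^ (2 * N + 1) * v.b
  c := v.c⁻¹
  q := v.q⁻¹
  f := fun j => if 1 ≤ j ∧ j ≤ 2 * N then v.f (2 * N + 1 - j) else v.f j

/-- Application of a chain of maps (in application order). -/
def apChain : List (Tup N K → Tup N K) → Tup N K → Tup N K
  | [], v => v
  | f :: fs, v => apChain fs (f v)

/-- All tuples appearing along a chain of maps have nonzero entries (in particular all
denominators arising in the composite are nonzero). -/
def okChain : List (Tup N K → Tup N K) → Tup N K → Prop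
  | [], v => Nz v
  | f :: fs, v => Nz v ∧ okChain fs (f v)

/-- The chain (in application order) representing `s_i` for `i ∈ ℤ/(2N+1)ℤ`:
for `i ≠ 0` it is `s_i` itself, and for `i = 0` it is `s₀ = π ∘ s₁ ∘ π⁻¹`. -/
def sL (i : ZMod (2 * N + 1)) : List (Tup N K → Tup N K) :=
  if i = 0 then [piInv, sMap 1, piMap] else [sMap i.val]

/-- The family `s_i`, `i ∈ ℤ/(2N+1)ℤ`, with `s₀ = π ∘ s₁ ∘ π⁻¹`. -/
def sFam (i : ZMod (2 * N + 1)) (v : Tup N K) : Tup N K := apChain (sL i) v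

theorem Tup.ext_of {L : Type*} {v w : Tup N L} (ha : ∀ j, v.a j = w.a j) (hb : v.b = w.b)
    (hc : v.c = w.c) (hq : v.q = w.q) (hf : ∀ j, v.f j = w.f j) : v = w := by
  cases v; cases w
  simp only [Tup.mk.injEq]
  exact ⟨funext ha, hb, hc, hq, funext hf⟩

/-- The action of the simple reflection `s_i`, `i ∈ ℤ/(2N+1)ℤ`, on the root variables. -/
def act (i : ZMod (2 * N + 1)) (a : ZMod (2 * N + 1) → K) (j : ZMod (2 * N + 1)) : K :=
  if j = i then (a j)⁻¹ else if j = i + 1 ∨ j = i - 1 then a i * a j else a j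

theorem zmod_natCast_ne {m k : ℕ} (hm : m < 2 * N + 1) (hk : k < 2 * N + 1) (h : m ≠ k) :
    (m : ZMod (2 * N + 1)) ≠ k := by
  rw [Ne, ZMod.natCast_eq_natCast_iff', Nat.mod_eq_of_lt hm, Nat.mod_eq_of_lt hk]
  exact h

theorem zmod_one_ne_zero (hN : 1 ≤ N) : (1 : ZMod (2 * N + 1)) ≠ 0 := by
  have := zmod_natCast_ne (N := N) (m := 1) (k := 0) (by omega) (by omega) (by omega)
  simpa using this

theorem zmod_two_ne_zero (hN : 1 ≤ N) : (2 : ZMod (2 * N + 1)) ≠ 0 := by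
  have := zmod_natCast_ne (N := N) (m := 2) (k := 0) (by omega) (by omega) (by omega)
  simpa using this

theorem act_act (hN : 1 ≤ N) (i : ZMod (2 * N + 1)) {a : ZMod (2 * N + 1) → K}
    (ha : ∀ j, a j ≠ 0) : act i (act i a) = a := by
  have h1 := zmod_one_ne_zero hN
  funext j
  have hi := ha i
  simp only [act]
  split_ifs <;> simp_all

theorem act_braid (hN : 1 ≤ N) (i : ZMod (2 * N + 1)) {a : ZMod (2 * N + 1) → K}
    (ha : ∀ j, a j ≠ 0) :
    act i (act (i + 1) (act i a)) = act (i + 1) (act i (act (i + 1) a)) := by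
  have h1 := zmod_one_ne_zero hN
  have h2 := zmod_two_ne_zero hN
  have e1 : i + 1 ≠ i := by simpa using h1
  have e2 : i + 1 - 1 = i := by ring
  have e3 : i ≠ i + 1 + 1 := by
    intro h; apply h2; linear_combination -h
  have e4 : i + 1 ≠ i - 1 := by
    intro h; apply h2; linear_combination h
  have hi := ha i
  have hi1 := ha (i + 1)
  funext j
  have hj := ha j
  by_cases j1 : j = i
  · subst j1
    simp [act, e1, e2, e3, e4, e1.symm]
    field_simp
  by_cases j2 : j = i + 1
  · subst j2
    simp [act, e1, e2, e3, e4, e1.symm]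
    field_simp
  simp only [act, e1, e2, e3, e4, e1.symm, j1, j2, if_true, if_false, or_true,
    or_false, false_or]
  split_ifs <;> first | contradiction | field_simp

theorem act_comm (i j : ZMod (2 * N + 1)) (h0 : j ≠ i) (h1 : j ≠ i + 1)
    (h2 : j ≠ i - 1) (a : ZMod (2 * N + 1) → K) :
    act i (act j a) = act j (act i a) := by
  have h1' : i ≠ j - 1 := by
    intro h; apply h1; rw [h]; ring
  have h2' : i ≠ j + 1 := by
    intro h; apply h2; rw [h]; ring
  funext k
  simp only [act]
  by_cases k1 : k = i
  · subst k1; simp [h0.symm, h1', h2']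
  by_cases k2 : k = j
  · subst k2; simp [h0, h1, h2]
  simp only [k1, k2, h0, h1, h2, h0.symm, h1', h2', if_false, or_false]
  split_ifs <;> ring

/-- The ratio multiplying a component `f j`. -/
def fac (i : ℕ) (v : Tup N K) : K :=
  (v.a i ^ (2 * N + 1) * mu v.c i - v.f i) / (mu v.c i - v.a i ^ (2 * N + 1) * v.f i)

/-- The multiplier of the `f`-components. -/
def scale (N i : ℕ) (x : K) (j : ℕ) : K :=
  if 1 ≤ j ∧ j + 1 = i then x⁻¹ else if j = i + 1 ∧ j ≤ 2 * N then x else 1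

theorem sMap_a (i : ℕ) (v : Tup N K) : (sMap i v).a = act (i : ZMod (2 * N + 1)) v.a := rfl

theorem sMap_f {i : ℕ} (hi : i ∈ Icc 1 (2 * N)) (v : Tup N K) (j : ℕ) :
    (sMap i v).f j = v.f j * scale N i (fac i v) j := by
  rw [mem_Icc] at hi
  simp only [sMap, scale, fac]
  by_cases h1 : 2 ≤ i ∧ j = i - 1
  · have h1' : 1 ≤ j ∧ j + 1 = i := by omega
    rw [if_pos h1, if_pos h1', inv_div, mul_div_assoc, h1.2]
  · have h1' : ¬(1 ≤ j ∧ j + 1 = i) := by omega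
    rw [if_neg h1, if_neg h1']
    by_cases h2 : i ≤ 2 * N - 1 ∧ j = i + 1
    · have h2' : j = i + 1 ∧ j ≤ 2 * N := by omega
      rw [if_pos h2, if_pos h2', mul_div_assoc, h2.2]
    · have h2' : ¬(j = i + 1 ∧ j ≤ 2 * N) := by omega
      rw [if_neg h2, if_neg h2', mul_one]

theorem sMap_f_self {i : ℕ} (hi : i ∈ Icc 1 (2 * N)) (v : Tup N K) :
    (sMap i v).f i = v.f i := by
  rw [sMap_f hi, scale, if_neg (by omega), if_neg (by omega), mul_one]

theorem fac_ne {i : ℕ} (hi : i ∈ Icc 1 (2 * N)) {v : Tup N K} (h : Nz (sMap i v)) :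
    v.a i ^ (2 * N + 1) * mu v.c i - v.f i ≠ 0 ∧
      mu v.c i - v.a i ^ (2 * N + 1) * v.f i ≠ 0 := by
  have key : fac i v ≠ 0 := by
    rw [mem_Icc] at hi
    intro h0
    by_cases hi2 : i = 1
    · have := h.2.2.2.2 2 (by simp; omega)
      rw [sMap_f (by simp; omega), scale, if_neg (by omega), if_pos (by omega), h0] at this
      simp at this
    · have := h.2.2.2.2 (i - 1) (by simp; omega)
      rw [sMap_f (by simp; omega), scale, if_pos (by omega), h0] at this
      simp at this
  rw [fac] at key
  exact div_ne_zero_iff.1 key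

theorem mu_ne {c : K} (hc : c ≠ 0) (i : ℕ) : mu c i ≠ 0 := by
  rw [mu]; split_ifs <;> simp [hc]

theorem mu_succ (c : K) (i : ℕ) : mu c (i + 1) = (mu c i)⁻¹ := by
  simp only [mu, Nat.odd_add_one]
  by_cases h : Odd i <;> simp [h]

theorem scale_mul (i j : ℕ) (x y : K) :
    scale N i x j * scale N i y j = scale N i (x * y) j := by
  simp only [scale]
  split_ifs <;> simp [mul_comm]

theorem scale_one (i j : ℕ) : scale N i (1 : K) j = 1 := by
  simp [scale]

theorem sMap_sMap (hN : 1 ≤ N) {i : ℕ} (hi : i ∈ Icc 1 (2 * N)) {v : Tup N K} (h0 : Nz v)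
    (h1 : Nz (sMap i v)) : sMap i (sMap i v) = v := by
  obtain ⟨n1, n2⟩ := fac_ne hi h1
  refine Tup.ext_of ?_ rfl rfl rfl ?_
  · intro j
    rw [sMap_a, sMap_a, act_act hN _ h0.1]
  · intro j
    rw [sMap_f hi, sMap_f hi, mul_assoc, scale_mul]
    have : fac i v * fac i (sMap i v) = 1 := by
      have ha := h0.1 i
      simp only [fac, sMap_f_self hi, sMap_a, act, if_true, inv_pow]
      have n3 : mu v.c i - (v.a i ^ (2 * N + 1))⁻¹ * v.f i ≠ 0 := by
        intro h; apply n1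
        field_simp at h
        linear_combination h
      change _ * (((v.a i ^ (2 * N + 1))⁻¹ * mu v.c i - v.f i) /
        (mu v.c i - (v.a i ^ (2 * N + 1))⁻¹ * v.f i)) = _
      field_simp
    rw [this, scale_one, mul_one]

theorem braid_factor_left {α β m F G x y z x' y' : K}
    (hm : m ≠ 0) (hx : x = (α * m - F) / (m - α * F)) (hx2 : m - α * F ≠ 0)
    (hy : y = (α * β * m⁻¹ - G * x) / (m⁻¹ - α * β * (G * x)))
    (hy1 : α * β * m⁻¹ - G * x ≠ 0) (hy2 : m⁻¹ - α * β * (G * x) ≠ 0)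
    (hz : z = (β * m - F * y⁻¹) / (m - β * (F * y⁻¹)))
    (hz2 : m - β * (F * y⁻¹) ≠ 0)
    (hx' : x' = (β * m⁻¹ - G) / (m⁻¹ - β * G)) (hx1' : β * m⁻¹ - G ≠ 0)
    (hx2' : m⁻¹ - β * G ≠ 0)
    (hy' : y' = (α * β * m - F * x'⁻¹) / (m - α * β * (F * x'⁻¹)))
    (hy2' : m - α * β * (F * x'⁻¹) ≠ 0) : x * z = y' := by
  have u1 : α * β * (m - α * F) - m * G * (α * m - F) ≠ 0 := by
    intro h; apply hy1; rw [hx]; field_simp; linear_combination h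
  have u2 : (m - α * F) - m * α * β * G * (α * m - F) ≠ 0 := by
    intro h; apply hy2; rw [hx]; field_simp; linear_combination h
  have ey : y⁻¹ = ((m - α * F) - m * α * β * G * (α * m - F)) /
      (α * β * (m - α * F) - m * G * (α * m - F)) := by
    rw [hy, hx, inv_div, div_eq_div_iff _ u1]
    · field_simp
    · rwa [← hx]
  have u3 : β - G * m ≠ 0 := by
    intro h; apply hx1'; field_simp; linear_combination h
  have u4 : 1 - β * G * m ≠ 0 := by
    intro h; apply hx2'; field_simp; linear_combination h
  have ex : x'⁻¹ = (1 - β * G * m) / (β - G * m) := by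
    rw [hx', inv_div, div_eq_div_iff hx1' u3]
    field_simp
  rw [hz, hy', hx, mul_div_assoc', div_eq_div_iff hz2 hy2', ey, ex]
  generalize hU : α * β * (m - α * F) - m * G * (α * m - F) = U at u1
  generalize hP : β - G * m = P at u3
  field_simp
  rw [← hU, ← hP]
  ring

theorem braid_factor_right {α β m F G x y x' y' z' : K}
    (hm : m ≠ 0) (hx : x = (α * m - F) / (m - α * F)) (hx2 : m - α * F ≠ 0)
    (hy : y = (α * β * m⁻¹ - G * x) / (m⁻¹ - α * β * (G * x)))
    (hy2 : m⁻¹ - α * β * (G * x) ≠ 0)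
    (hx' : x' = (β * m⁻¹ - G) / (m⁻¹ - β * G)) (hx1' : β * m⁻¹ - G ≠ 0)
    (hx2' : m⁻¹ - β * G ≠ 0)
    (hy' : y' = (α * β * m - F * x'⁻¹) / (m - α * β * (F * x'⁻¹)))
    (hy1' : α * β * m - F * x'⁻¹ ≠ 0) (hy2' : m - α * β * (F * x'⁻¹) ≠ 0)
    (hz' : z' = (α * m⁻¹ - G * y') / (m⁻¹ - α * (G * y')))
    (hz2' : m⁻¹ - α * (G * y') ≠ 0) : y = x' * z' := by
  have u3 : β - G * m ≠ 0 := by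
    intro h; apply hx1'; field_simp; linear_combination h
  have u4 : 1 - β * G * m ≠ 0 := by
    intro h; apply hx2'; field_simp; linear_combination h
  have ex : x' = (β - G * m) / (1 - β * G * m) := by
    rw [hx', div_eq_div_iff hx2' u4]
    field_simp
  have u1 : α * β * m * (β - G * m) - F * (1 - β * G * m) ≠ 0 := by
    intro h; apply hy1'
    rw [ex, inv_div, mul_div_assoc', sub_eq_zero, eq_div_iff u3]
    linear_combination h
  have u2 : m * (β - G * m) - α * β * F * (1 - β * G * m) ≠ 0 := by
    intro h; apply hy2'
    rw [ex, inv_div, mul_div_assoc', mul_div_assoc', sub_eq_zero, eq_div_iff u3]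
    linear_combination h
  have ey : y' = (α * β * m * (β - G * m) - F * (1 - β * G * m)) /
      (m * (β - G * m) - α * β * F * (1 - β * G * m)) := by
    rw [hy', div_eq_div_iff hy2' u2, ex, inv_div]
    generalize β - G * m = P at u3
    field_simp
  rw [hz', mul_div_assoc', hy, div_eq_div_iff hy2 hz2', ey, ex, hx]
  generalize hU : m * (β - G * m) - α * β * F * (1 - β * G * m) = U at u2
  generalize hP : 1 - β * G * m = P at u4
  generalize hR : m - α * F = R at hx2
  field_simp
  rw [← hU, ← hP, ← hR]
  ring

theorem sMap_c (i : ℕ) (v : Tup N K) : (sMap i v).c = v.c := rfl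

theorem sMap_a_self (i : ℕ) (v : Tup N K) : (sMap i v).a i = (v.a i)⁻¹ := by
  rw [sMap_a, act, if_pos rfl]

theorem sMap_a_succ (hN : 1 ≤ N) (i : ℕ) (v : Tup N K) :
    (sMap i v).a ((i + 1 : ℕ) : ZMod (2 * N + 1)) =
      v.a i * v.a ((i + 1 : ℕ) : ZMod (2 * N + 1)) := by
  have := zmod_one_ne_zero hN
  rw [sMap_a, act, if_neg (by simpa using this), if_pos (by simp)]

theorem sMap_succ_a (hN : 1 ≤ N) (i : ℕ) (v : Tup N K) :
    (sMap (i + 1) v).a i = v.a ((i + 1 : ℕ) : ZMod (2 * N + 1)) * v.a i := by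
  have := zmod_one_ne_zero hN
  rw [sMap_a, act, if_neg (by simpa using this), if_pos (by simp)]

theorem sMap_f_succ {i : ℕ} (hi : i ∈ Icc 1 (2 * N - 1)) (v : Tup N K) :
    (sMap i v).f (i + 1) = v.f (i + 1) * fac i v := by
  rw [mem_Icc] at hi
  have h : i + 1 = i + 1 ∧ i + 1 ≤ 2 * N := by omega
  rw [sMap_f (by simp; omega), scale, if_neg (by omega), if_pos h]

theorem sMap_succ_f {i : ℕ} (hi : i ∈ Icc 1 (2 * N - 1)) (v : Tup N K) :
    (sMap (i + 1) v).f i = v.f i * (fac (i + 1) v)⁻¹ := by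
  rw [mem_Icc] at hi
  rw [sMap_f (by simp; omega), scale, if_pos (by omega)]

theorem sMap_braid (hN : 1 ≤ N) {i : ℕ} (hi : i ∈ Icc 1 (2 * N - 1)) {v : Tup N K} (h0 : Nz v)
    (h1 : Nz (sMap i v)) (h2 : Nz (sMap (i + 1) (sMap i v)))
    (h3 : Nz (sMap i (sMap (i + 1) (sMap i v)))) (h1' : Nz (sMap (i + 1) v))
    (h2' : Nz (sMap i (sMap (i + 1) v))) (h3' : Nz (sMap (i + 1) (sMap i (sMap (i + 1) v)))) :
    sMap i (sMap (i + 1) (sMap i v)) = sMap (i + 1) (sMap i (sMap (i + 1) v)) := by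
  have hi0 : i ∈ Icc 1 (2 * N) := by rw [mem_Icc] at *; omega
  have hi1 : i + 1 ∈ Icc 1 (2 * N) := by rw [mem_Icc] at *; omega
  have ai := h0.1 i
  have aj := h0.1 ((i + 1 : ℕ) : ZMod (2 * N + 1))
  have n1 := fac_ne hi0 h1
  have n2 := fac_ne hi1 h2
  have n3 := fac_ne hi0 h3
  have n1' := fac_ne hi1 h1'
  have n2' := fac_ne hi0 h2'
  have n3' := fac_ne hi1 h3'
  have hx : fac i v = _ / _ := rfl
  have hy : fac (i + 1) (sMap i v) = _ / _ := rfl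
  have hz : fac i (sMap (i + 1) (sMap i v)) = _ / _ := rfl
  have hx' : fac (i + 1) v = _ / _ := rfl
  have hy' : fac i (sMap (i + 1) v) = _ / _ := rfl
  have hz' : fac (i + 1) (sMap i (sMap (i + 1) v)) = _ / _ := rfl
  have hm := mu_ne h0.2.2.1 i
  have ea : v.a ((i + 1 : ℕ) : ZMod (2 * N + 1)) * v.a i * (v.a ((i + 1 : ℕ) : ZMod (2 * N + 1)))⁻¹
      = v.a i := by field_simp
  have eb : v.a i * v.a ((i + 1 : ℕ) : ZMod (2 * N + 1)) * (v.a i)⁻¹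
      = v.a ((i + 1 : ℕ) : ZMod (2 * N + 1)) := by field_simp
  have ec : v.a ((i + 1 : ℕ) : ZMod (2 * N + 1)) * v.a i
      = v.a i * v.a ((i + 1 : ℕ) : ZMod (2 * N + 1)) := mul_comm _ _
  simp only [sMap_succ_a hN, sMap_a_succ hN, sMap_f_succ hi, sMap_succ_f hi, sMap_c, mu_succ,
    sMap_f_self hi0, sMap_f_self hi1, sMap_a_self, ea, eb] at hy hz hy' hz' n2 n3 n2' n3' n1' hx'
  rw [ec] at hy' n2'
  simp only [mul_pow] at hy hy' n2 n2'
  have k1 := braid_factor_left hm hx n1.2 hy n2.1 n2.2 hz n3.2 hx' n1'.1 n1'.2 hy' n2'.2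
  have k2 := braid_factor_right hm hx n1.2 hy n2.2 hx' n1'.1 n1'.2 hy' n2'.1 n2'.2 hz' n3'.2
  refine Tup.ext_of ?_ rfl rfl rfl ?_
  · intro j
    simp only [sMap_a]
    push_cast
    rw [act_braid hN _ h0.1]
  · intro j
    rw [sMap_f hi0, sMap_f hi1, sMap_f hi0, sMap_f hi1, sMap_f hi0, sMap_f hi1, ← k1, k2,
      ← scale_mul, ← scale_mul]
    ring

theorem sMap_comm {i j : ℕ} (hi : i ∈ Icc 1 (2 * N)) (hj : j ∈ Icc 1 (2 * N))
    (hij : i + 2 ≤ j ∨ j + 2 ≤ i) (v : Tup N K) :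
    sMap i (sMap j v) = sMap j (sMap i v) := by
  rw [mem_Icc] at hi hj
  have key : ∀ {i j : ℕ}, 1 ≤ i → j ≤ 2 * N → i + 2 ≤ j →
      (j : ZMod (2 * N + 1)) ≠ i ∧ (j : ZMod (2 * N + 1)) ≠ i + 1 ∧
      (j : ZMod (2 * N + 1)) ≠ i - 1 := by
    intro i j h1 h2 h3
    refine ⟨zmod_natCast_ne (by omega) (by omega) (by omega), ?_, ?_⟩
    · exact_mod_cast zmod_natCast_ne (N := N) (m := j) (k := i + 1) (by omega) (by omega) (by omega)
    · have := zmod_natCast_ne (N := N) (m := j) (k := i - 1) (by omega) (by omega) (by omega)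
      rwa [Nat.cast_sub h1, Nat.cast_one] at this
  have key' : (j : ZMod (2 * N + 1)) ≠ i ∧ (j : ZMod (2 * N + 1)) ≠ i + 1 ∧
      (j : ZMod (2 * N + 1)) ≠ i - 1 := by
    rcases hij with h | h
    · exact key hi.1 hj.2 h
    · obtain ⟨k1, k2, k3⟩ := key hj.1 hi.2 h
      refine ⟨k1.symm, ?_, ?_⟩
      · intro h; apply k3; rw [h]; ring
      · intro h; apply k2; rw [h]; ring
  have f1 : fac i (sMap j v) = fac i v := by
    have : (sMap j v).f i = v.f i := by
      rw [sMap_f (by simp; omega), scale, if_neg (by omega), if_neg (by omega), mul_one]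
    have ha : (sMap j v).a i = v.a i := by
      rw [sMap_a, act, if_neg key'.1.symm, if_neg]
      rintro (h | h)
      · apply key'.2.2; rw [h]; ring
      · apply key'.2.1; rw [h]; ring
    rw [fac, fac, this, ha, sMap_c]
  have f2 : fac j (sMap i v) = fac j v := by
    have : (sMap i v).f j = v.f j := by
      rw [sMap_f (by simp; omega), scale, if_neg (by omega), if_neg (by omega), mul_one]
    have ha : (sMap i v).a j = v.a j := by
      rw [sMap_a, act, if_neg key'.1, if_neg (not_or.2 key'.2)]
    rw [fac, fac, this, ha, sMap_c]
  refine Tup.ext_of ?_ rfl rfl rfl ?_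
  · intro k
    simp only [sMap_a]
    rw [act_comm _ _ key'.1 key'.2.1 key'.2.2]
  · intro k
    rw [sMap_f (by simp; omega), sMap_f (by simp; omega), sMap_f (by simp; omega),
      sMap_f (by simp; omega), f1, f2]
    ring

theorem w1_w1 {v : Tup N K} (h0 : v.q ≠ 0) : w1 (w1 v) = v := by
  refine Tup.ext_of ?_ ?_ ?_ ?_ ?_
  · intro j; simp [w1]
  · simp only [w1, inv_pow]; field_simp
  · simp [w1]
  · simp [w1]
  · intro j
    simp only [w1]
    split_ifs with h1 h2
    · congr 1; omega
    · omega
    · rfl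

theorem Nz_w1 {v : Tup N K} (h0 : Nz v) : Nz (w1 v) := by
  obtain ⟨h1, h2, h3, h4, h5⟩ := h0
  refine ⟨fun j => inv_ne_zero (h1 _), mul_ne_zero (pow_ne_zero _ h4) h2, inv_ne_zero h3,
    inv_ne_zero h4, fun j hj => ?_⟩
  rw [mem_Icc] at hj
  simp only [w1]
  rw [if_pos hj]
  exact h5 _ (by rw [mem_Icc]; omega)

theorem act_neg (i : ZMod (2 * N + 1)) (a : ZMod (2 * N + 1) → K) (j : ZMod (2 * N + 1)) :
    (act i (fun k => (a (-k))⁻¹) (-j))⁻¹ = act (-i) a j := by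
  have e1 : -j = i ↔ j = -i := neg_eq_iff_eq_neg
  have e2 : -j = i + 1 ↔ j = -i - 1 := by rw [neg_eq_iff_eq_neg, neg_add, sub_eq_add_neg]
  have e3 : -j = i - 1 ↔ j = -i + 1 := by rw [neg_eq_iff_eq_neg]; ring_nf
  simp only [act, e1, e2, e3, neg_neg, or_comm (a := j = -i - 1)]
  split_ifs <;> simp [mul_comm]

theorem w1_f {v : Tup N K} {j : ℕ} (hj : j ∈ Icc 1 (2 * N)) :
    (w1 v).f j = v.f (2 * N + 1 - j) := by
  rw [mem_Icc] at hj
  exact if_pos hj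

theorem w1_f' {v : Tup N K} {j : ℕ} (hj : j ∉ Icc 1 (2 * N)) :
    (w1 v).f j = v.f j := by
  rw [mem_Icc] at hj
  exact if_neg hj

theorem zmod_cast_sub {k : ℕ} (hk : k ≤ 2 * N + 1) :
    ((2 * N + 1 - k : ℕ) : ZMod (2 * N + 1)) = -k := by
  rw [Nat.cast_sub hk, ZMod.natCast_self, zero_sub]

theorem scale_of_notMem {i j : ℕ} (hi : i ∈ Icc 1 (2 * N)) (hj : j ∉ Icc 1 (2 * N)) (x : K) :
    scale N i x j = 1 := by
  rw [mem_Icc] at *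
  rw [scale, if_neg (by omega), if_neg (by omega)]

theorem fac_w1 {k : ℕ} (hk : k ∈ Icc 1 (2 * N)) {v : Tup N K} (h0 : Nz v) :
    fac k (w1 v) = (fac (2 * N + 1 - k) v)⁻¹ := by
  have hk' := mem_Icc.1 hk
  have ha := h0.1 (-(k : ZMod (2 * N + 1)))
  have hmu : mu (w1 v).c k = mu v.c (2 * N + 1 - k) := by
    have : Odd (2 * N + 1 - k) ↔ ¬ Odd k := by
      rw [Nat.odd_sub (by omega)]; simp
    simp only [mu, this, w1]
    by_cases h : Odd k <;> simp [h]
  rw [fac, fac, hmu, w1_f hk, zmod_cast_sub (by omega), inv_div]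
  simp only [w1, inv_pow]
  rw [← mul_div_mul_left _ _ (pow_ne_zero (2 * N + 1) ha)]
  congr 1 <;> field_simp

theorem w1_sMap {k : ℕ} (hk : k ∈ Icc 1 (2 * N)) {v : Tup N K} (h0 : Nz v) :
    w1 (sMap k (w1 v)) = sMap (2 * N + 1 - k) v := by
  have hk' := mem_Icc.1 hk
  have hk2 : 2 * N + 1 - k ∈ Icc 1 (2 * N) := by rw [mem_Icc]; omega
  have hq := h0.2.2.2.1
  refine Tup.ext_of ?_ ?_ ?_ ?_ ?_
  · intro j
    rw [sMap_a, zmod_cast_sub (by omega), ← act_neg]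
    rfl
  · simp only [w1, sMap, inv_pow]; field_simp
  · simp [w1, sMap]
  · simp [w1, sMap]
  · intro j
    by_cases hj : j ∈ Icc 1 (2 * N)
    · have hj2 : 2 * N + 1 - j ∈ Icc 1 (2 * N) := by rw [mem_Icc] at *; omega
      have hj' := mem_Icc.1 hj
      rw [w1_f hj, sMap_f hk, sMap_f hk2, w1_f hj2, fac_w1 hk h0]
      have : 2 * N + 1 - (2 * N + 1 - j) = j := by omega
      rw [this]
      congr 1
      have e1 : (1 ≤ 2 * N + 1 - j ∧ 2 * N + 1 - j + 1 = k) ↔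
        (j = 2 * N + 1 - k + 1 ∧ j ≤ 2 * N) := by omega
      have e2 : (2 * N + 1 - j = k + 1 ∧ 2 * N + 1 - j ≤ 2 * N) ↔
        (1 ≤ j ∧ j + 1 = 2 * N + 1 - k) := by omega
      simp only [scale, e1, e2, inv_inv]
      by_cases c1 : j = 2 * N + 1 - k + 1 ∧ j ≤ 2 * N
      · have c2 : ¬ (1 ≤ j ∧ j + 1 = 2 * N + 1 - k) := by omega
        rw [if_pos c1, if_neg c2, if_pos c1]
      · rw [if_neg c1, if_neg c1]
    · rw [w1_f' hj, sMap_f hk, sMap_f hk2, w1_f' hj, scale_of_notMem hk hj,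
        scale_of_notMem hk2 hj]

theorem prod_zmod (F : ZMod (2 * N + 1) → K) :
    ∏ j, F j = ∏ k ∈ range (2 * N + 1), F k := by
  rw [← Fin.prod_univ_eq_prod_range (fun k => F (k : ZMod (2 * N + 1)))]
  refine Finset.prod_congr rfl fun j _ => ?_
  congr 1
  exact (ZMod.natCast_zmod_val (n := 2 * N + 1) j).symm

theorem prod_ite_zpow (i : ZMod (2 * N + 1)) (x : K) (e : ZMod (2 * N + 1) → ℤ) :
    ∏ j, (if j = i then x else 1) ^ e j = x ^ e i := by
  rw [Finset.prod_eq_single i]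
  · simp
  · intro j _ hj; simp [hj]
  · simp

theorem prod_act (hN : 1 ≤ N) (i : ZMod (2 * N + 1)) {a : ZMod (2 * N + 1) → K}
    (ha : ∀ j, a j ≠ 0) (e : ZMod (2 * N + 1) → ℤ) :
    ∏ j, act i a j ^ e j = (∏ j, a j ^ e j) * a i ^ (e (i + 1) + e (i - 1) - 2 * e i) := by
  have h1 := zmod_one_ne_zero hN
  have h2 := zmod_two_ne_zero hN
  have e1 : i + 1 ≠ i := by simpa using h1
  have e2 : i - 1 ≠ i := by simpa using h1
  have e3 : i + 1 ≠ i - 1 := by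
    intro h; apply h2; linear_combination h
  have hi := ha i
  have key : ∀ j, act i a j = a j * (if j = i then (a i ^ 2)⁻¹ else 1) *
      (if j = i + 1 then a i else 1) * (if j = i - 1 then a i else 1) := by
    intro j
    rw [act]
    by_cases j1 : j = i
    · subst j1
      simp only [e1.symm, e2.symm, if_true, if_false, mul_one]
      field_simp
    by_cases j2 : j = i + 1
    · subst j2
      simp [e1, e3, mul_comm]
    by_cases j3 : j = i - 1
    · subst j3
      simp [e2, e3.symm, mul_comm]
    simp [j1, j2, j3]
  simp only [key, mul_zpow, Finset.prod_mul_distrib, prod_ite_zpow]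
  rw [mul_assoc, mul_assoc]
  congr 1
  have hsq : (a i ^ 2)⁻¹ ^ e i = a i ^ (-(2 * e i)) := by
    rw [← zpow_natCast, ← zpow_neg, ← zpow_mul]
    push_cast
    rw [neg_mul]
  rw [show e (i + 1) + e (i - 1) - 2 * e i = -(2 * e i) + (e (i + 1) + e (i - 1)) by ring,
    zpow_add₀ hi, zpow_add₀ hi, hsq]

/-- The weight of `a j` in the monomial `mono`. -/
def wt (j : ZMod (2 * N + 1)) : ℤ := (j.val : ℤ) - (2 * N - 1)

/-- The monomial in the root variables that enters the map `π`. -/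
def mono (a : ZMod (2 * N + 1) → K) : K := ∏ j, a j ^ wt j

theorem wt_natCast {k : ℕ} (hk : k < 2 * N + 1) :
    wt (k : ZMod (2 * N + 1)) = k - (2 * N - 1) := by
  rw [wt, ZMod.val_natCast_of_lt hk]

theorem wt_zero : wt (0 : ZMod (2 * N + 1)) = -(2 * N - 1) := by
  simp [wt]

theorem natCast_two_mul : ((2 * N : ℕ) : ZMod (2 * N + 1)) = -1 := by
  rw [eq_neg_iff_add_eq_zero]
  exact_mod_cast ZMod.natCast_self (2 * N + 1)

theorem wt_neg_one : wt (-1 : ZMod (2 * N + 1)) = 1 := by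
  rw [← natCast_two_mul, wt_natCast (by omega)]
  push_cast; ring

theorem exists_natCast (j : ZMod (2 * N + 1)) : ∃ k : ℕ, k < 2 * N + 1 ∧ j = k :=
  ⟨j.val, ZMod.val_lt j, (ZMod.natCast_zmod_val j).symm⟩

theorem wt_pred (j : ZMod (2 * N + 1)) :
    wt (j - 1) = wt j - 1 + (if j = 0 then (2 * N + 1 : ℤ) else 0) := by
  obtain ⟨k, hk, rfl⟩ := exists_natCast j
  by_cases h : k = 0
  · subst h
    simp only [Nat.cast_zero, if_true, zero_sub, wt_neg_one, wt_zero]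
    ring
  · have h' : (k : ZMod (2 * N + 1)) ≠ 0 := by
      exact_mod_cast zmod_natCast_ne hk (by omega : 0 < 2 * N + 1) h
    have : (k : ZMod (2 * N + 1)) - 1 = ((k - 1 : ℕ) : ZMod (2 * N + 1)) := by
      rw [Nat.cast_sub (by omega), Nat.cast_one]
    rw [if_neg h', this, wt_natCast hk, wt_natCast (by omega), Nat.cast_sub (by omega)]
    push_cast; ring

theorem wt_neg (j : ZMod (2 * N + 1)) :
    -wt (-j) = wt j + (2 * N - 3) + (if j = 0 then (2 * N + 1 : ℤ) else 0) := by
  obtain ⟨k, hk, rfl⟩ := exists_natCast j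
  by_cases h : k = 0
  · subst h
    simp only [Nat.cast_zero, if_true, neg_zero, wt_zero]
    ring
  · have h' : (k : ZMod (2 * N + 1)) ≠ 0 := by
      exact_mod_cast zmod_natCast_ne hk (by omega : 0 < 2 * N + 1) h
    rw [if_neg h', ← zmod_cast_sub hk.le, wt_natCast hk, wt_natCast (by omega),
      Nat.cast_sub hk.le]
    push_cast; ring

theorem wt_succ {k : ℕ} (hk : k + 1 < 2 * N + 1) :
    wt ((k : ZMod (2 * N + 1)) + 1) = wt (k : ZMod (2 * N + 1)) + 1 := by
  have : ((k : ZMod (2 * N + 1)) + 1) = ((k + 1 : ℕ) : ZMod (2 * N + 1)) := by push_cast; rfl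
  rw [this, wt_natCast hk, wt_natCast (by omega)]
  push_cast; ring

theorem mono_act (hN : 1 ≤ N) {k : ℕ} (hk : k ∈ Icc 1 (2 * N - 1)) {a : ZMod (2 * N + 1) → K}
    (ha : ∀ j, a j ≠ 0) : mono (act (k : ZMod (2 * N + 1)) a) = mono a := by
  rw [mem_Icc] at hk
  have h' : (k : ZMod (2 * N + 1)) ≠ 0 := by
    exact_mod_cast zmod_natCast_ne (N := N) (m := k) (k := 0) (by omega) (by omega) (by omega)
  rw [mono, prod_act hN _ ha, wt_pred, if_neg h', wt_succ (by omega)]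
  ring_nf
  simp [mono]

theorem mono_act_zero (hN : 1 ≤ N) {a : ZMod (2 * N + 1) → K}
    (ha : ∀ j, a j ≠ 0) : mono (act 0 a) = a 0 ^ (2 * N + 1) * mono a := by
  have h1 : wt ((0 : ZMod (2 * N + 1)) + 1) = wt (0 : ZMod (2 * N + 1)) + 1 := by
    exact_mod_cast wt_succ (N := N) (k := 0) (by omega)
  rw [mono, prod_act hN _ ha, wt_pred, if_pos rfl, h1, mul_comm, mono, ← zpow_natCast]
  congr 2
  push_cast; ring

theorem prod_zpow_const (a : ZMod (2 * N + 1) → K) (m : ℤ) :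
    ∏ j, a j ^ m = (∏ j, a j) ^ m := by
  rw [Finset.prod_zpow]

theorem prod_zpow_ite_zero (a : ZMod (2 * N + 1) → K) (m : ℤ) :
    ∏ j, a j ^ (if j = 0 then m else 0) = a 0 ^ m := by
  rw [Finset.prod_eq_single 0]
  · simp
  · intro j _ hj; simp [hj]
  · simp

theorem mono_neg {a : ZMod (2 * N + 1) → K} (ha : ∀ j, a j ≠ 0) :
    mono (fun j => (a (-j))⁻¹) =
      mono a * (∏ j, a j) ^ (2 * N - 3 : ℤ) * a 0 ^ (2 * N + 1) := by
  rw [mono, ← Equiv.prod_comp (Equiv.neg (ZMod (2 * N + 1)))]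
  simp only [Equiv.neg_apply, neg_neg, inv_zpow', wt_neg]
  simp only [zpow_add₀ (ha _), Finset.prod_mul_distrib, prod_zpow_ite_zero,
    prod_zpow_const]
  rw [← zpow_natCast]
  push_cast
  rw [zpow_add₀ (ha 0)]
  rfl

theorem mono_mul_prod {a : ZMod (2 * N + 1) → K} (ha : ∀ j, a j ≠ 0) :
    mono a * ∏ k ∈ Icc 1 (2 * N - 1), a k ^ (2 * N - k) =
      (∏ j, a j) * (a 0 ^ (2 * N))⁻¹ := by
  have h1 : ∏ k ∈ Icc 1 (2 * N - 1), a k ^ (2 * N - k) =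
      ∏ k ∈ range (2 * N + 1), a k ^ (if k = 0 then 0 else 2 * N - k) := by
    refine (Finset.prod_congr rfl fun k hk => ?_).trans
      (Finset.prod_subset (s₁ := Icc 1 (2 * N - 1)) ?_ ?_)
    · rw [mem_Icc] at hk
      rw [if_neg (by omega)]
    · intro k hk
      rw [mem_Icc] at hk
      rw [mem_range]; omega
    · intro k hk hk'
      rw [mem_range] at hk
      rw [mem_Icc] at hk'
      split_ifs
      · simp
      · rw [show 2 * N - k = 0 by omega, pow_zero]
  have h2 : (a 0 ^ (2 * N))⁻¹ =
      ∏ k ∈ range (2 * N + 1), (if k = 0 then (a k ^ (2 * N))⁻¹ else 1) := by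
    rw [Finset.prod_ite_eq' (range (2 * N + 1)) 0 (fun k : ℕ => (a k ^ (2 * N))⁻¹)]
    simp
  rw [mono, prod_zmod, prod_zmod, h1, h2, ← Finset.prod_mul_distrib, ← Finset.prod_mul_distrib]
  refine Finset.prod_congr rfl fun k hk => ?_
  rw [mem_range] at hk
  rw [wt_natCast hk, ← zpow_natCast, ← zpow_add₀ (ha _)]
  by_cases h : k = 0
  · subst h
    have := ha 0
    simp only [if_true, Nat.cast_zero]
    rw [show ((0 : ℤ) - (2 * N - 1) + 0) = 1 + -((2 * N : ℕ) : ℤ) by push_cast; ring,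
      zpow_add₀ this, zpow_neg, zpow_natCast, zpow_one]
  · simp only [h, if_false, mul_one]
    rw [Nat.cast_sub (by omega)]
    rw [show ((k : ℤ) - (2 * N - 1) + (((2 * N : ℕ) : ℤ) - k)) = 1 by push_cast; ring, zpow_one]

theorem mono_mul_prod_shift (hN : 1 ≤ N) {a : ZMod (2 * N + 1) → K} (ha : ∀ j, a j ≠ 0) :
    mono a * ∏ k ∈ Icc 1 (2 * N - 1), a ((k : ZMod (2 * N + 1)) - 1) ^ (2 * N - k) = a (-1) := by
  obtain ⟨m, hm⟩ : ∃ m, 2 * N = m + 1 := ⟨2 * N - 1, by omega⟩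
  have h1 : ∏ k ∈ Icc 1 (2 * N - 1), a ((k : ZMod (2 * N + 1)) - 1) ^ (2 * N - k) =
      ∏ k ∈ range m, a (k : ZMod (2 * N + 1)) ^ (m - k) := by
    have : Icc 1 (2 * N - 1) = Ico 1 (m + 1) := by ext; simp; omega
    rw [this, Finset.prod_Ico_eq_prod_range, Nat.add_sub_cancel]
    refine Finset.prod_congr rfl fun k hk => ?_
    rw [show 2 * N - (1 + k) = m - k by omega]
    push_cast
    congr 2
    ring
  rw [mono, prod_zmod, h1, show range (2 * N + 1) = range (m + 1 + 1) by rw [hm],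
    Finset.prod_range_succ, Finset.prod_range_succ, mul_right_comm, mul_right_comm _ _ (∏ _ ∈ _, _),
    ← Finset.prod_mul_distrib, Finset.prod_eq_one, ← hm, natCast_two_mul, wt_neg_one,
    wt_natCast (by omega), zpow_one, one_mul]
  · have : (m : ℤ) - (2 * N - 1) = 0 := by omega
    rw [this, zpow_zero, one_mul]
  · intro k hk
    rw [mem_range] at hk
    rw [wt_natCast (by omega), ← zpow_natCast, ← zpow_add₀ (ha _)]
    have : (k : ℤ) - (2 * N - 1) + ((m - k : ℕ) : ℤ) = 0 := by omega
    rw [this, zpow_zero]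

theorem C_iff {v : Tup N K} : C v ↔ ∏ j, v.a j = v.q := by
  rw [C, prod_zmod]

theorem prod_act_one (hN : 1 ≤ N) (i : ZMod (2 * N + 1)) {a : ZMod (2 * N + 1) → K}
    (ha : ∀ j, a j ≠ 0) : ∏ j, act i a j = ∏ j, a j := by
  simpa using prod_act hN i ha (fun _ => 1)

theorem C_sMap (hN : 1 ≤ N) (i : ℕ) {v : Tup N K} (h0 : Nz v) (hC : C v) : C (sMap i v) := by
  rw [C_iff] at *
  rw [sMap_a, prod_act_one hN _ h0.1, hC]
  rfl

theorem C_w1 {v : Tup N K} (hC : C v) : C (w1 v) := by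
  rw [C_iff] at *
  simp only [w1]
  rw [Finset.prod_inv_distrib]
  exact congrArg _ ((Equiv.prod_comp (Equiv.neg (ZMod (2 * N + 1))) v.a).trans hC)

theorem C_piInv {v : Tup N K} (hC : C v) : C (piInv v) := by
  rw [C_iff] at *
  exact (Equiv.prod_comp (Equiv.subRight (1 : ZMod (2 * N + 1))) v.a).trans hC

/-- The additive term in the last component of `π`. -/
def xTerm (v : Tup N K) : K :=
  v.q ^ (2 * N) * v.a 0 * v.b / ((∏ k ∈ Icc 1 (2 * N - 1), v.a k ^ (2 * N - k)) * v.c)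

/-- The additive term in the first component of `π⁻¹`. -/
def yTerm (v : Tup N K) : K := v.q ^ (2 * N - 1) * v.b * v.c * mono v.a

/-- The product of the components `f j` with odd `j`. -/
def oddProd (v : Tup N K) : K := ∏ k ∈ Icc 1 N, v.f (2 * k - 1)

/-- The product of the components `f j` with even `j`. -/
def evenProd (v : Tup N K) : K := ∏ k ∈ Icc 1 N, v.f (2 * k)

theorem Qval_eq (v : Tup N K) :
    Qval v = -(v.c ^ 4 / oddProd v) * (evenProd v + xTerm v) := rfl

theorem oddProd_ne_zero {v : Tup N K} (h0 : Nz v) : oddProd v ≠ 0 :=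
  Finset.prod_ne_zero_iff.2 fun k hk => h0.2.2.2.2 _ (by rw [mem_Icc] at *; omega)

theorem evenProd_ne_zero {v : Tup N K} (h0 : Nz v) : evenProd v ≠ 0 :=
  Finset.prod_ne_zero_iff.2 fun k hk => h0.2.2.2.2 _ (by rw [mem_Icc] at *; omega)

theorem q_pow (hN : 1 ≤ N) (q : K) : q ^ (2 * N) = q ^ (2 * N - 1) * q := by
  rw [← pow_succ]; congr 1; omega

theorem xTerm_eq (hN : 1 ≤ N) {v : Tup N K} (h0 : Nz v) (hC : C v) :
    xTerm v = v.a 0 ^ (2 * N + 1) * yTerm v / v.c ^ 2 := by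
  obtain ⟨ha, hb, hc, hq, hf⟩ := h0
  have h := mono_mul_prod ha
  rw [C_iff.1 hC] at h
  have h1 := ha 0
  have hP : ∏ k ∈ Icc 1 (2 * N - 1), v.a k ^ (2 * N - k) ≠ 0 :=
    Finset.prod_ne_zero_iff.2 fun k _ => pow_ne_zero _ (ha k)
  rw [xTerm, yTerm, div_eq_div_iff (mul_ne_zero hP hc) (pow_ne_zero 2 hc), q_pow hN]
  have h2 : mono v.a * (∏ k ∈ Icc 1 (2 * N - 1), v.a k ^ (2 * N - k)) * v.a 0 ^ (2 * N) = v.q := by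
    rw [h]; field_simp
  linear_combination -(v.q ^ (2 * N - 1) * v.a 0 * v.b * v.c ^ 2) * h2

theorem xTerm_piInv (hN : 1 ≤ N) {v : Tup N K} (h0 : Nz v) : xTerm (piInv v) = yTerm v := by
  obtain ⟨ha, hb, hc, hq, hf⟩ := h0
  have h := mono_mul_prod_shift hN ha
  have hP : ∏ k ∈ Icc 1 (2 * N - 1), v.a ((k : ZMod (2 * N + 1)) - 1) ^ (2 * N - k) ≠ 0 :=
    Finset.prod_ne_zero_iff.2 fun k _ => pow_ne_zero _ (ha _)
  rw [xTerm, yTerm]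
  simp only [piInv, zero_sub]
  rw [q_pow hN, ← h]
  field_simp

theorem yTerm_w1 (hN : 1 ≤ N) {v : Tup N K} (h0 : Nz v) (hC : C v) :
    yTerm (w1 v) = xTerm v := by
  rw [xTerm_eq hN h0 hC]
  obtain ⟨ha, hb, hc, hq, hf⟩ := h0
  rw [yTerm, yTerm]
  simp only [w1]
  rw [mono_neg ha, C_iff.1 hC]
  have : (v.q⁻¹) ^ (2 * N - 1) * v.q ^ (2 * N + 1) * v.q ^ (2 * N - 3 : ℤ) = v.q ^ (2 * N - 1) := by
    rw [← zpow_natCast, ← zpow_natCast, ← zpow_natCast, inv_zpow', ← zpow_add₀ hq, ← zpow_add₀ hq,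
      Nat.cast_sub (by omega)]
    congr 1
    push_cast; ring
  rw [← this]
  field_simp

theorem yTerm_sMap (hN : 1 ≤ N) {k : ℕ} (hk : k ∈ Icc 1 (2 * N - 1)) {v : Tup N K} (h0 : Nz v) :
    yTerm (sMap k v) = yTerm v := by
  rw [yTerm, yTerm, sMap_a, mono_act hN hk h0.1]
  rfl

theorem prod_scale_odd {i : ℕ} (hi : i ∈ Icc 1 (2 * N - 1)) {x : K} (hx : x ≠ 0) :
    ∏ k ∈ Icc 1 N, scale N i x (2 * k - 1) = 1 := by
  rw [mem_Icc] at hi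
  have key : ∀ k ∈ Icc 1 N, scale N i x (2 * k - 1) =
      if i % 2 = 0 then (if k = i / 2 then x⁻¹ else 1) * (if k = i / 2 + 1 then x else 1)
      else 1 := by
    intro k hk
    rw [mem_Icc] at hk
    rw [scale]
    split_ifs <;> first | (simp; done) | (exfalso; omega)
  rw [Finset.prod_congr rfl key]
  split_ifs with h
  · rw [Finset.prod_mul_distrib, Finset.prod_ite_eq', Finset.prod_ite_eq', if_pos, if_pos,
      inv_mul_cancel₀ hx] <;> rw [mem_Icc] <;> omega
  · simp

theorem prod_scale_even {i : ℕ} (hi : i ∈ Icc 2 (2 * N)) {x : K} (hx : x ≠ 0) :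
    ∏ k ∈ Icc 1 N, scale N i x (2 * k) = 1 := by
  rw [mem_Icc] at hi
  have key : ∀ k ∈ Icc 1 N, scale N i x (2 * k) =
      if i % 2 = 0 then 1 else
        (if k = i / 2 then x⁻¹ else 1) * (if k = i / 2 + 1 then x else 1) := by
    intro k hk
    rw [mem_Icc] at hk
    rw [scale]
    split_ifs <;> first | (simp; done) | (exfalso; omega)
  rw [Finset.prod_congr rfl key]
  split_ifs with h
  · simp
  · rw [Finset.prod_mul_distrib, Finset.prod_ite_eq', Finset.prod_ite_eq', if_pos, if_pos,
      inv_mul_cancel₀ hx] <;> rw [mem_Icc] <;> omega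

theorem prod_scale_last (hN : 1 ≤ N) (x : K) :
    ∏ k ∈ Icc 1 N, scale N (2 * N) x (2 * k - 1) = x⁻¹ := by
  rw [Finset.prod_eq_single N]
  · rw [scale, if_pos (by omega)]
  · intro k hk hkN
    rw [mem_Icc] at hk
    rw [scale, if_neg (by omega), if_neg (by omega)]
  · intro h; simp [hN] at h

theorem prod_scale_first (hN : 1 ≤ N) (x : K) :
    ∏ k ∈ Icc 1 N, scale N 1 x (2 * k) = x := by
  rw [Finset.prod_eq_single 1]
  · rw [scale, if_neg (by omega), if_pos (by omega)]
  · intro k hk hkN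
    rw [mem_Icc] at hk
    rw [scale, if_neg (by omega), if_neg (by omega)]
  · intro h; simp [hN] at h

theorem fac_ne_zero {i : ℕ} (hi : i ∈ Icc 1 (2 * N)) {v : Tup N K} (h : Nz (sMap i v)) :
    fac i v ≠ 0 :=
  div_ne_zero (fac_ne hi h).1 (fac_ne hi h).2

theorem oddProd_sMap {i : ℕ} (hi : i ∈ Icc 1 (2 * N - 1)) {v : Tup N K} (h : Nz (sMap i v)) :
    oddProd (sMap i v) = oddProd v := by
  have hi' : i ∈ Icc 1 (2 * N) := by rw [mem_Icc] at *; omega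
  simp only [oddProd, sMap_f hi', Finset.prod_mul_distrib]
  rw [prod_scale_odd hi (fac_ne_zero hi' h), mul_one]

theorem evenProd_sMap {i : ℕ} (hi : i ∈ Icc 2 (2 * N)) {v : Tup N K} (h : Nz (sMap i v)) :
    evenProd (sMap i v) = evenProd v := by
  have hi' : i ∈ Icc 1 (2 * N) := by rw [mem_Icc] at *; omega
  simp only [evenProd, sMap_f hi', Finset.prod_mul_distrib]
  rw [prod_scale_even hi (fac_ne_zero hi' h), mul_one]

theorem oddProd_sMap_last (hN : 1 ≤ N) (v : Tup N K) :
    oddProd (sMap (2 * N) v) = oddProd v * (fac (2 * N) v)⁻¹ := by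
  have h : 2 * N ∈ Icc 1 (2 * N) := by rw [mem_Icc]; omega
  simp only [oddProd, sMap_f h, Finset.prod_mul_distrib]
  rw [prod_scale_last hN]

theorem evenProd_sMap_first (hN : 1 ≤ N) (v : Tup N K) :
    evenProd (sMap 1 v) = evenProd v * fac 1 v := by
  have h : 1 ∈ Icc 1 (2 * N) := by rw [mem_Icc]; omega
  simp only [evenProd, sMap_f h, Finset.prod_mul_distrib]
  rw [prod_scale_first hN]

theorem oddProd_w1 (v : Tup N K) : oddProd (w1 v) = evenProd v := by
  refine Finset.prod_nbij' (fun k => N + 1 - k) (fun k => N + 1 - k) ?_ ?_ ?_ ?_ ?_ <;>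
    intro k hk <;> rw [mem_Icc] at hk
  · rw [mem_Icc]; omega
  · rw [mem_Icc]; omega
  · omega
  · omega
  · rw [w1_f (by rw [mem_Icc]; omega)]
    congr 1; omega

theorem evenProd_w1 (v : Tup N K) : evenProd (w1 v) = oddProd v := by
  refine Finset.prod_nbij' (fun k => N + 1 - k) (fun k => N + 1 - k) ?_ ?_ ?_ ?_ ?_ <;>
    intro k hk <;> rw [mem_Icc] at hk
  · rw [mem_Icc]; omega
  · rw [mem_Icc]; omega
  · omega
  · omega
  · rw [w1_f (by rw [mem_Icc]; omega)]
    congr 1; omega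

/-- The common denominator of the multipliers in `s₀`. -/
def den (v : Tup N K) : K :=
  v.c ^ 2 * evenProd v + v.a 0 ^ (2 * N + 1) * (oddProd v + yTerm v)

/-- The numerator of the multiplier of `f 1` in `s₀`. -/
def numFst (v : Tup N K) : K :=
  v.a 0 ^ (2 * N + 1) * (v.c ^ 2 * evenProd v) + oddProd v + yTerm v

/-- The numerator of the multiplier of `f (2N)` in `s₀`. -/
def numLst (v : Tup N K) : K :=
  v.a 0 ^ (2 * N + 1) * (v.c ^ 2 * evenProd v) + oddProd v +
    (v.a 0 ^ (2 * N + 1)) ^ 2 * yTerm v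

/-- The explicit form of `s₀`. -/
def t0 (v : Tup N K) : Tup N K where
  a := act 0 v.a
  b := v.b
  c := v.c
  q := v.q
  f := fun j => v.f j * ((if j = 1 then numFst v / den v else 1) *
    (if j = 2 * N then numLst v / den v else 1))

theorem oddProd_t0 (hN : 1 ≤ N) (v : Tup N K) :
    oddProd (t0 v) = oddProd v * (numFst v / den v) := by
  simp only [oddProd, t0, Finset.prod_mul_distrib]
  congr 1
  rw [Finset.prod_eq_single 1, Finset.prod_eq_one, if_pos rfl, mul_one]
  · intro k hk
    rw [mem_Icc] at hk
    rw [if_neg (by omega)]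
  · intro k hk hk1
    rw [mem_Icc] at hk
    rw [if_neg (by omega)]
  · intro h; simp [hN] at h

theorem evenProd_t0 (hN : 1 ≤ N) (v : Tup N K) :
    evenProd (t0 v) = evenProd v * (numLst v / den v) := by
  simp only [evenProd, t0, Finset.prod_mul_distrib]
  congr 1
  rw [mul_comm, Finset.prod_eq_single N, Finset.prod_eq_one, if_pos rfl, mul_one]
  · intro k hk
    rw [if_neg (by omega)]
  · intro k hk hk1
    rw [if_neg (by omega)]
  · intro h; simp [hN] at h

theorem yTerm_t0 (hN : 1 ≤ N) {v : Tup N K} (h0 : Nz v) :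
    yTerm (t0 v) = v.a 0 ^ (2 * N + 1) * yTerm v := by
  simp only [yTerm, t0, mono_act_zero hN h0.1]
  ring

theorem C_t0 (hN : 1 ≤ N) {v : Tup N K} (h0 : Nz v) (hC : C v) : C (t0 v) := by
  rw [C_iff] at *
  simp only [t0]
  rw [prod_act_one hN _ h0.1, hC]

theorem t0_ne (hN : 1 ≤ N) {v : Tup N K} (h : Nz (t0 v)) :
    numFst v ≠ 0 ∧ numLst v ≠ 0 ∧ den v ≠ 0 := by
  have h1 := h.2.2.2.2 1 (by rw [mem_Icc]; omega)
  have h2 := h.2.2.2.2 (2 * N) (by rw [mem_Icc]; omega)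
  simp only [t0, if_true] at h1 h2
  have h3 := right_ne_zero_of_mul (right_ne_zero_of_mul h2)
  have h4 := left_ne_zero_of_mul (right_ne_zero_of_mul h1)
  rw [div_ne_zero_iff] at h3 h4
  exact ⟨h4.1, h3⟩

theorem ite_one_mul_ite (p : Prop) [Decidable p] (x y : K) :
    ((if p then x else 1) * if p then y else 1) = if p then x * y else 1 := by
  split_ifs <;> simp

theorem t0_t0 (hN : 1 ≤ N) {v : Tup N K} (h0 : Nz v) (h1 : Nz (t0 v)) : t0 (t0 v) = v := by
  obtain ⟨n1, n2, n3⟩ := t0_ne hN h1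
  have hA : v.a 0 ^ (2 * N + 1) ≠ 0 := pow_ne_zero _ (h0.1 0)
  have hA' : (t0 v).a 0 ^ (2 * N + 1) = (v.a 0 ^ (2 * N + 1))⁻¹ := by
    simp [t0, act]
  have hc : (t0 v).c = v.c := rfl
  have hm : v.c ^ 2 ≠ 0 := pow_ne_zero _ h0.2.2.1
  have hO := oddProd_t0 hN v
  have hE := evenProd_t0 hN v
  have hY := yTerm_t0 hN h0
  have hd : den v = v.c ^ 2 * evenProd v + v.a 0 ^ (2 * N + 1) * (oddProd v + yTerm v) := rfl
  have hn1 : numFst v = v.a 0 ^ (2 * N + 1) * (v.c ^ 2 * evenProd v) + oddProd v + yTerm v := rfl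
  have hn2 : numLst v = v.a 0 ^ (2 * N + 1) * (v.c ^ 2 * evenProd v) + oddProd v +
    (v.a 0 ^ (2 * N + 1)) ^ 2 * yTerm v := rfl
  have e1 : den (t0 v) = numFst v * numLst v / (v.a 0 ^ (2 * N + 1) * den v) := by
    rw [den, hA', hc, hO, hE, hY, eq_div_iff (mul_ne_zero hA n3)]
    generalize v.a 0 ^ (2 * N + 1) = A at *
    generalize den v = D at *
    field_simp
    rw [hd, hn1, hn2]
    ring
  have e2 : numFst (t0 v) = numLst v / v.a 0 ^ (2 * N + 1) := by
    rw [numFst, hA', hc, hO, hE, hY, eq_div_iff hA]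
    generalize v.a 0 ^ (2 * N + 1) = A at *
    generalize den v = D at *
    field_simp
    rw [hd, hn1, hn2]
    ring
  have e3 : numLst (t0 v) = numFst v / v.a 0 ^ (2 * N + 1) := by
    rw [numLst, hA', hc, hO, hE, hY, eq_div_iff hA]
    generalize v.a 0 ^ (2 * N + 1) = A at *
    generalize den v = D at *
    field_simp
    rw [hd, hn1, hn2]
    ring
  have r1 : numFst v / den v * (numFst (t0 v) / den (t0 v)) = 1 := by
    rw [e1, e2]; field_simp
  have r2 : numLst v / den v * (numLst (t0 v) / den (t0 v)) = 1 := by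
    rw [e1, e3]; field_simp
  refine Tup.ext_of (fun j => congrFun (act_act hN _ h0.1) j) rfl rfl rfl fun j => ?_
  change v.f j * _ * _ = _
  rw [mul_assoc, mul_mul_mul_comm, ite_one_mul_ite, ite_one_mul_ite, r1, r2]
  simp

theorem affine_braid_factors {A B m E O Y F x y z D n l d1 n1 l1 d2 n2 l2 : K}
    (hD : D = m * E + A * (O + Y)) (hn : n = A * (m * E) + O + Y)
    (hl : l = A * (m * E) + O + A ^ 2 * Y)
    (hx : x = (B * m - F) / (m - B * F))
    (hd1 : d1 = m * (E * x) + A * B * (O + Y)) (hn1 : n1 = A * B * (m * (E * x)) + O + Y)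
    (hl1 : l1 = A * B * (m * (E * x)) + O + (A * B) ^ 2 * Y)
    (hz : z = (A * m - F * (n1 / d1)) / (m - A * (F * (n1 / d1))))
    (hy : y = (A * B * m - F * (n / D)) / (m - A * B * (F * (n / D))))
    (hd2 : d2 = m * (E * (l / D) * y) + B * (O * (n / D) + A * Y))
    (hn2 : n2 = B * (m * (E * (l / D) * y)) + O * (n / D) + A * Y)
    (hl2 : l2 = B * (m * (E * (l / D) * y)) + O * (n / D) + B ^ 2 * (A * Y))
    (D0 : D ≠ 0) (n0 : n ≠ 0) (l0 : l ≠ 0) (P0 : B * m - F ≠ 0) (Q0 : m - B * F ≠ 0)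
    (d10 : d1 ≠ 0)
    (V0 : m - A * B * (F * (n / D)) ≠ 0) :
    x * z = y ∧ n1 / d1 = n / D * (n2 / d2) ∧ l1 / d1 = l / D * (l2 / d2) := by
  obtain ⟨P, hP⟩ : ∃ P, P = B * m - F := ⟨_, rfl⟩
  obtain ⟨Q, hQ⟩ : ∃ Q, Q = m - B * F := ⟨_, rfl⟩
  obtain ⟨D1, hD1⟩ : ∃ D1, D1 = m * E * P + A * B * (O + Y) * Q := ⟨_, rfl⟩
  obtain ⟨N1, hN1⟩ : ∃ N1, N1 = A * B * (m * E) * P + (O + Y) * Q := ⟨_, rfl⟩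
  obtain ⟨L1, hL1⟩ : ∃ L1, L1 = A * B * (m * E) * P + (O + (A * B) ^ 2 * Y) * Q := ⟨_, rfl⟩
  obtain ⟨U, hU⟩ : ∃ U, U = A * B * m * D - F * n := ⟨_, rfl⟩
  obtain ⟨V, hV⟩ : ∃ V, V = m * D - A * B * F * n := ⟨_, rfl⟩
  have i1 : m * E * l * U + B * (O * n + A * Y * D) * V = n * l * D1 := by
    rw [hU, hV, hD1, hP, hQ, hn, hl, hD]; ring
  have i2 : B * (m * E) * l * U + (O * n + A * Y * D) * V = D * l * N1 := by
    rw [hU, hV, hN1, hP, hQ, hn, hl, hD]; ring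
  have i3 : B * (m * E) * l * U + (O * n + B ^ 2 * (A * Y) * D) * V = D * n * L1 := by
    rw [hU, hV, hL1, hP, hQ, hn, hl, hD]; ring
  have i4 : A * m * D1 - F * N1 = Q * U := by
    rw [hU, hD1, hN1, hP, hQ, hn, hD]; ring
  have i5 : m * D1 - A * F * N1 = P * V := by
    rw [hV, hD1, hN1, hP, hQ, hn, hD]; ring
  rw [← hP] at P0
  rw [← hQ] at Q0
  rw [← hP, ← hQ] at hx
  have V0' : V ≠ 0 := by
    have : m - A * B * (F * (n / D)) = V / D := by
      rw [hV]; field_simp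
    intro h; apply V0; rw [this, h, zero_div]
  have ey : y = U / V := by
    rw [hy, div_eq_div_iff V0 V0', hU, hV]; field_simp
  have ed1 : d1 = D1 / Q := by
    rw [hd1, hD1, hx]; field_simp
  have en1 : n1 = N1 / Q := by
    rw [hn1, hN1, hx]; field_simp; ring
  have el1 : l1 = L1 / Q := by
    rw [hl1, hL1, hx]; field_simp; ring
  have D10 : D1 ≠ 0 := by
    intro h; apply d10; rw [ed1, h, zero_div]
  have ed2 : d2 = n * l * D1 / (D * V) := by
    rw [← i1, hd2, ey]; field_simp
  have en2 : n2 = l * N1 / V := by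
    rw [eq_div_iff V0', hn2, ey]; field_simp
    linear_combination i2
  have el2 : l2 = n * L1 / V := by
    rw [eq_div_iff V0', hl2, ey]; field_simp
    linear_combination i3
  have r1 : n1 / d1 = N1 / D1 := by
    rw [en1, ed1]; field_simp
  refine ⟨?_, ?_, ?_⟩
  · have : z = Q * U / (P * V) := by
      rw [hz, r1, ← i4, ← i5]; field_simp
    rw [this, hx, ey]; field_simp
  · rw [r1, en2, ed2]; field_simp
  · rw [el1, ed1, el2, ed2]; field_simp

theorem t0_a_zero (v : Tup N K) : (t0 v).a 0 = (v.a 0)⁻¹ := by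
  simp [t0, act]

theorem t0_a_one (hN : 1 ≤ N) (v : Tup N K) : (t0 v).a 1 = v.a 0 * v.a 1 := by
  simp [t0, act, zmod_one_ne_zero hN]

theorem t0_f_first (v : Tup N K) : (t0 v).f 1 = v.f 1 * (numFst v / den v) := by
  have : 1 ≠ 2 * N := by omega
  simp [t0, this]

theorem sMap_one_a_zero (hN : 1 ≤ N) (v : Tup N K) : (sMap 1 v).a 0 = v.a 0 * v.a 1 := by
  have h := sMap_succ_a hN 0 v
  simpa [mul_comm] using h

theorem sMap_one_a_one (v : Tup N K) : (sMap 1 v).a 1 = (v.a 1)⁻¹ := by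
  simpa using sMap_a_self 1 v

theorem fac_one (v : Tup N K) : fac 1 v =
    (v.a 1 ^ (2 * N + 1) * v.c ^ 2 - v.f 1) / (v.c ^ 2 - v.a 1 ^ (2 * N + 1) * v.f 1) := by
  simp [fac, mu]

theorem t0_braid (hN : 1 ≤ N) {v : Tup N K} (h0 : Nz v)
    (a1 : Nz (sMap 1 v)) (a2 : Nz (t0 (sMap 1 v))) (b1 : Nz (t0 v))
    (b2 : Nz (sMap 1 (t0 v))) :
    t0 (sMap 1 (t0 v)) = sMap 1 (t0 (sMap 1 v)) := by
  have hm1 : 1 ∈ Icc 1 (2 * N - 1) := by rw [mem_Icc]; omega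
  have hm : 1 ∈ Icc 1 (2 * N) := by rw [mem_Icc]; omega
  obtain ⟨n0, l0, D0⟩ := t0_ne hN b1
  obtain ⟨-, -, d10⟩ := t0_ne hN a2
  have f1 := fac_ne hm a1
  have f2 := (fac_ne hm b2).2
  have hB : v.a 1 ≠ 0 := h0.1 1
  have hA : v.a 0 ≠ 0 := h0.1 0
  simp only [mu, odd_one, if_true, Nat.cast_one] at f1 f2
  have eb : (t0 (sMap 1 v)).a 1 = v.a 0 := by
    rw [t0_a_one hN, sMap_one_a_zero hN, sMap_one_a_one]; field_simp
  have ea : (sMap 1 (t0 v)).a 0 = v.a 1 := by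
    rw [sMap_one_a_zero hN, t0_a_one hN, t0_a_zero]; field_simp
  obtain ⟨k1, k2, k3⟩ := affine_braid_factors (A := v.a 0 ^ (2 * N + 1)) (B := v.a 1 ^ (2 * N + 1))
    (m := v.c ^ 2) (E := evenProd v) (O := oddProd v) (Y := yTerm v) (F := v.f 1)
    (x := fac 1 v) (y := fac 1 (t0 v)) (z := fac 1 (t0 (sMap 1 v)))
    (d1 := den (sMap 1 v)) (n1 := numFst (sMap 1 v)) (l1 := numLst (sMap 1 v))
    (d2 := den (sMap 1 (t0 v))) (n2 := numFst (sMap 1 (t0 v))) (l2 := numLst (sMap 1 (t0 v)))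
    (D := den v) (n := numFst v) (l := numLst v) rfl rfl rfl (fac_one v)
    (by rw [den, sMap_one_a_zero hN, evenProd_sMap_first hN, oddProd_sMap hm1 a1,
          yTerm_sMap hN hm1 h0, sMap_c, mul_pow])
    (by rw [numFst, sMap_one_a_zero hN, evenProd_sMap_first hN, oddProd_sMap hm1 a1,
          yTerm_sMap hN hm1 h0, sMap_c, mul_pow])
    (by rw [numLst, sMap_one_a_zero hN, evenProd_sMap_first hN, oddProd_sMap hm1 a1,
          yTerm_sMap hN hm1 h0, sMap_c, mul_pow])
    (by rw [fac_one, eb, t0_f_first, sMap_f_self hm]; rfl)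
    (by rw [fac_one, t0_a_one hN, t0_f_first, mul_pow]; rfl)
    (by rw [den, ea, evenProd_sMap_first hN, oddProd_sMap hm1 b2, yTerm_sMap hN hm1 b1,
          evenProd_t0 hN, oddProd_t0 hN, yTerm_t0 hN h0]; rfl)
    (by rw [numFst, ea, evenProd_sMap_first hN, oddProd_sMap hm1 b2, yTerm_sMap hN hm1 b1,
          evenProd_t0 hN, oddProd_t0 hN, yTerm_t0 hN h0]; rfl)
    (by rw [numLst, ea, evenProd_sMap_first hN, oddProd_sMap hm1 b2, yTerm_sMap hN hm1 b1,
          evenProd_t0 hN, oddProd_t0 hN, yTerm_t0 hN h0]; rfl)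
    D0 n0 l0 f1.1 f1.2 d10
    (by rw [t0_a_one hN, t0_f_first, mul_pow] at f2; exact f2)
  refine Tup.ext_of (fun j => ?_) rfl rfl rfl fun j => ?_
  · have h := act_braid hN (0 : ZMod (2 * N + 1)) h0.1
    have := congrFun h j
    simp only [zero_add] at this
    simpa only [t0, sMap_a, Nat.cast_one] using this
  · rw [sMap_f hm]
    change (sMap 1 (t0 v)).f j * _ = (sMap 1 v).f j * _ * _
    rw [sMap_f hm, sMap_f hm]
    change v.f j * _ * _ * _ = _
    rw [← k1, ← scale_mul, k2, k3, ← ite_one_mul_ite, ← ite_one_mul_ite]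
    ring

theorem sMap_a_zero {j : ℕ} (hj : j ∈ Icc 2 (2 * N - 1)) (v : Tup N K) :
    (sMap j v).a 0 = v.a 0 := by
  rw [mem_Icc] at hj
  have e1 := zmod_natCast_ne (N := N) (m := 0) (k := j) (by omega) (by omega) (by omega)
  have e2 := zmod_natCast_ne (N := N) (m := 0) (k := j + 1) (by omega) (by omega) (by omega)
  have e3 := zmod_natCast_ne (N := N) (m := 1) (k := j) (by omega) (by omega) (by omega)
  push_cast at e1 e2 e3
  have e4 : (0 : ZMod (2 * N + 1)) ≠ j - 1 := by
    intro h; apply e3; linear_combination h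
  rw [sMap_a, act, if_neg e1, if_neg (by tauto)]

theorem den_num_sMap (hN : 1 ≤ N) {j : ℕ} (hj : j ∈ Icc 2 (2 * N - 1)) {v : Tup N K}
    (h0 : Nz v) (h1 : Nz (sMap j v)) : den (sMap j v) = den v ∧ numFst (sMap j v) = numFst v ∧
      numLst (sMap j v) = numLst v := by
  have hj' := mem_Icc.1 hj
  have hj1 : j ∈ Icc 1 (2 * N - 1) := by rw [mem_Icc]; omega
  have hj2 : j ∈ Icc 2 (2 * N) := by rw [mem_Icc]; omega
  simp only [den, numFst, numLst, sMap_a_zero hj, oddProd_sMap hj1 h1, evenProd_sMap hj2 h1,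
    yTerm_sMap hN hj1 h0, sMap_c, true_and]

theorem t0_comm (hN : 1 ≤ N) {j : ℕ} (hj : j ∈ Icc 2 (2 * N - 1)) {v : Tup N K} (h0 : Nz v)
    (h1 : Nz (sMap j v)) : t0 (sMap j v) = sMap j (t0 v) := by
  obtain ⟨k1, k2, k3⟩ := den_num_sMap hN hj h0 h1
  rw [mem_Icc] at hj
  have hj1 : j ∈ Icc 1 (2 * N) := by rw [mem_Icc]; omega
  have e1 := zmod_natCast_ne (N := N) (m := j) (k := 0) (by omega) (by omega) (by omega)
  have e2 := zmod_natCast_ne (N := N) (m := j + 1) (k := 0) (by omega) (by omega) (by omega)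
  have e3 := zmod_natCast_ne (N := N) (m := j) (k := 1) (by omega) (by omega) (by omega)
  push_cast at e1 e2 e3
  have e4 : (j : ZMod (2 * N + 1)) ≠ 0 + 1 := by simpa using e3
  have e5 : (j : ZMod (2 * N + 1)) ≠ 0 - 1 := by
    intro h; apply e2; linear_combination h
  have ef : fac j (t0 v) = fac j v := by
    have a1 : (t0 v).a j = v.a j := by
      simp only [t0, act]
      rw [if_neg e1, if_neg (by tauto)]
    have a2 : (t0 v).f j = v.f j := by
      simp only [t0]
      rw [if_neg (by omega), if_neg (by omega), mul_one, mul_one]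
    rw [fac, fac, a1, a2]
    rfl
  refine Tup.ext_of (fun i => ?_) rfl rfl rfl fun i => ?_
  · exact congrFun (act_comm 0 (j : ZMod (2 * N + 1)) e1 e4 e5 v.a) i
  · rw [sMap_f hj1, ef]
    change (sMap j v).f i * _ = v.f i * _ * _
    rw [sMap_f hj1, k1, k2, k3]
    ring

theorem w1_t0_w1 (hN : 1 ≤ N) {v : Tup N K} (h0 : Nz v) (hC : C v) : w1 (t0 (w1 v)) = t0 v := by
  have hq := h0.2.2.2.1
  have hc := h0.2.2.1
  have hA : v.a 0 ^ (2 * N + 1) ≠ 0 := pow_ne_zero _ (h0.1 0)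
  have ha : (w1 v).a 0 ^ (2 * N + 1) = (v.a 0 ^ (2 * N + 1))⁻¹ := by simp [w1]
  have hcc : (w1 v).c = v.c⁻¹ := rfl
  have hY : yTerm (w1 v) = v.a 0 ^ (2 * N + 1) * yTerm v / v.c ^ 2 := by
    rw [yTerm_w1 hN h0 hC, xTerm_eq hN h0 hC]
  have k1 : den (w1 v) = den v / (v.a 0 ^ (2 * N + 1) * v.c ^ 2) := by
    simp only [den, ha, hcc, hY, oddProd_w1, evenProd_w1]
    field_simp
    ring
  have k2 : numFst (w1 v) = numLst v / (v.a 0 ^ (2 * N + 1) * v.c ^ 2) := by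
    simp only [numFst, numLst, ha, hcc, hY, oddProd_w1, evenProd_w1]
    field_simp
    ring
  have k3 : numLst (w1 v) = numFst v / (v.a 0 ^ (2 * N + 1) * v.c ^ 2) := by
    simp only [numFst, numLst, ha, hcc, hY, oddProd_w1, evenProd_w1]
    field_simp
    ring
  have hs : v.a 0 ^ (2 * N + 1) * v.c ^ 2 ≠ 0 := mul_ne_zero hA (pow_ne_zero 2 hc)
  refine Tup.ext_of (fun j => ?_) (congrArg Tup.b (w1_w1 hq) :)
    (congrArg Tup.c (w1_w1 hq) :) (congrArg Tup.q (w1_w1 hq) :) fun j => ?_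
  · have h := act_neg (0 : ZMod (2 * N + 1)) v.a j
    rw [neg_zero] at h
    exact h
  · by_cases hj : j ∈ Icc 1 (2 * N)
    · have hj' := mem_Icc.1 hj
      have hj2 : 2 * N + 1 - j ∈ Icc 1 (2 * N) := by rw [mem_Icc]; omega
      have c1 : 2 * N + 1 - j = 1 ↔ j = 2 * N := by omega
      have c2 : 2 * N + 1 - j = 2 * N ↔ j = 1 := by omega
      rw [w1_f hj]
      simp only [t0, c1, c2]
      rw [w1_f hj2, k1, k2, k3, div_div_div_cancel_right₀ hs, div_div_div_cancel_right₀ hs,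
        show 2 * N + 1 - (2 * N + 1 - j) = j by omega, mul_comm (if j = 2 * N then _ else _)]
    · have hj' := mt mem_Icc.2 hj
      rw [w1_f' hj]
      simp only [t0]
      rw [w1_f' hj, if_neg (by omega), if_neg (by omega), if_neg (by omega), if_neg (by omega)]

theorem piMap_f {v : Tup N K} {j : ℕ} (hj : j ∈ Icc 1 (2 * N - 1)) :
    (piMap v).f j = v.f (j + 1) := if_pos (mem_Icc.1 hj)

theorem piMap_f_last (hN : 1 ≤ N) (v : Tup N K) : (piMap v).f (2 * N) = Qval v := by
  simp only [piMap]
  rw [if_neg (by omega), if_pos trivial]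

theorem piMap_f_of_notMem (hN : 1 ≤ N) {v : Tup N K} {j : ℕ} (hj : j ∉ Icc 1 (2 * N)) :
    (piMap v).f j = v.f j := by
  rw [mem_Icc] at hj
  simp only [piMap]
  rw [if_neg (by omega), if_neg (by omega)]

theorem prod_odd_succ (hN : 1 ≤ N) (g : ℕ → K) :
    ∏ k ∈ Icc 1 N, g (2 * k - 1) = g 1 * ∏ k ∈ Icc 1 (N - 1), g (2 * k + 1) := by
  have h : Icc 1 N = insert 1 (Icc 2 N) := by ext; simp; omega
  rw [h, Finset.prod_insert (by simp)]
  congr 1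
  refine Finset.prod_nbij' (fun k => k - 1) (fun k => k + 1) ?_ ?_ ?_ ?_ ?_ <;>
    intro k hk <;> rw [mem_Icc] at hk
  · rw [mem_Icc]; omega
  · rw [mem_Icc]; omega
  · omega
  · omega
  · congr 1; omega

theorem prod_even_pred (hN : 1 ≤ N) (g : ℕ → K) :
    ∏ k ∈ Icc 1 N, g (2 * k) = (∏ k ∈ Icc 1 (N - 1), g (2 * k)) * g (2 * N) := by
  obtain ⟨m, rfl⟩ : ∃ m, N = m + 1 := ⟨N - 1, by omega⟩
  rw [Finset.prod_Icc_succ_top (by omega), Nat.add_sub_cancel]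

theorem piInv_f {v : Tup N K} {j : ℕ} (hj : j ∈ Icc 2 (2 * N)) :
    (piInv v).f j = v.f (j - 1) := by
  rw [mem_Icc] at hj
  simp only [piInv]
  rw [if_neg (by omega), if_pos hj]

theorem piInv_f_first (hN : 1 ≤ N) {v : Tup N K} (h0 : Nz v) :
    (piInv v).f 1 = -(v.c⁻¹ ^ 4 * (oddProd v + yTerm v)) / evenProd v := by
  rw [← xTerm_piInv hN h0, evenProd, prod_even_pred hN]
  simp only [piInv, xTerm, oddProd, if_true, zero_sub]

theorem piInv_f_of_notMem (hN : 1 ≤ N) {v : Tup N K} {j : ℕ} (hj : j ∉ Icc 1 (2 * N)) :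
    (piInv v).f j = v.f j := by
  rw [mem_Icc] at hj
  simp only [piInv]
  rw [if_neg (by omega), if_neg (by omega)]

theorem evenProd_piInv (v : Tup N K) : evenProd (piInv v) = oddProd v := by
  refine Finset.prod_congr rfl fun k hk => ?_
  rw [mem_Icc] at hk
  rw [piInv_f (by rw [mem_Icc]; omega)]

theorem oddProd_piInv (hN : 1 ≤ N) {v : Tup N K} (h0 : Nz v) :
    oddProd (piInv v) * v.f (2 * N) = -(v.c⁻¹ ^ 4 * (oddProd v + yTerm v)) := by
  have hE := evenProd_ne_zero h0
  have h : oddProd (piInv v) * v.f (2 * N) = (piInv v).f 1 * evenProd v := by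
    rw [evenProd, prod_even_pred hN, oddProd, prod_odd_succ hN, mul_assoc]
    congr 2
    refine Finset.prod_congr rfl fun k hk => ?_
    rw [mem_Icc] at hk
    rw [piInv_f (by rw [mem_Icc]; omega), Nat.add_sub_cancel]
  rw [h, piInv_f_first hN h0, div_mul_cancel₀ _ hE]

theorem piMap_piInv (hN : 1 ≤ N) {v : Tup N K} (h0 : Nz v) (h1 : Nz (piInv v)) :
    piMap (piInv v) = v := by
  have hq := h0.2.2.2.1
  have hc := h0.2.2.1
  have hf := h0.2.2.2.2 (2 * N) (by rw [mem_Icc]; omega)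
  refine Tup.ext_of (fun j => ?_) ?_ (inv_inv _) rfl fun j => ?_
  · simp [piMap, piInv]
  · simp only [piMap, piInv]; field_simp
  · by_cases h : j ∈ Icc 1 (2 * N - 1)
    · rw [piMap_f h, piInv_f (by rw [mem_Icc] at *; omega), Nat.add_sub_cancel]
    by_cases h2 : j = 2 * N
    · subst h2
      have hO := oddProd_piInv hN h0
      have hO' := oddProd_ne_zero h1
      rw [piMap_f_last hN, Qval_eq, evenProd_piInv, xTerm_piInv hN h0]
      change -(v.c⁻¹ ^ 4 / _) * _ = _
      field_simp at hO ⊢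
      linear_combination -hO
    have h3 : j ∉ Icc 1 (2 * N) := by rw [mem_Icc] at *; omega
    rw [piMap_f_of_notMem hN h3, piInv_f_of_notMem hN h3]

theorem w1_piMap_w1 (hN : 1 ≤ N) {v : Tup N K} (h0 : Nz v) (hC : C v) :
    w1 (piMap (w1 v)) = piInv v := by
  have hq := h0.2.2.2.1
  refine Tup.ext_of (fun j => ?_) ?_ ?_ ?_ fun j => ?_
  · simp only [w1, piMap, piInv, inv_inv]
    congr 1; ring
  · simp only [w1, piMap, piInv, inv_pow]; field_simp
  · simp [w1, piMap, piInv]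
  · simp [w1, piMap, piInv]
  · by_cases h : j ∈ Icc 2 (2 * N)
    · have h' := mem_Icc.1 h
      rw [w1_f (by rw [mem_Icc]; omega), piMap_f (by rw [mem_Icc]; omega),
        w1_f (by rw [mem_Icc]; omega), piInv_f h]
      congr 1; omega
    by_cases h2 : j = 1
    · subst h2
      have hX := yTerm_w1 hN (Nz_w1 h0) (C_w1 hC)
      rw [w1_w1 hq] at hX
      rw [w1_f (by rw [mem_Icc]; omega), Nat.add_sub_cancel, piMap_f_last hN,
        Qval_eq, oddProd_w1, evenProd_w1, ← hX, piInv_f_first hN h0]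
      change -(v.c⁻¹ ^ 4 / _) * _ = _
      ring
    have h3 : j ∉ Icc 1 (2 * N) := by rw [mem_Icc] at *; omega
    rw [w1_f' h3, piMap_f_of_notMem hN h3, w1_f' h3, piInv_f_of_notMem hN h3]

theorem act_shift (i s : ZMod (2 * N + 1)) (a : ZMod (2 * N + 1) → K) (j : ZMod (2 * N + 1)) :
    act i (fun k => a (k + s)) j = act (i + s) a (j + s) := by
  have e1 : j + s = i + s + 1 ↔ j = i + 1 := by
    rw [add_right_comm, add_left_inj]
  have e2 : j + s = i + s - 1 ↔ j = i - 1 := by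
    rw [add_sub_right_comm, add_left_inj]
  simp only [act, add_left_inj, e1, e2]

theorem mono_act_neg_one (hN : 1 ≤ N) {a : ZMod (2 * N + 1) → K} (ha : ∀ j, a j ≠ 0) :
    mono (act (-1) a) = (a (-1) ^ (2 * N + 1))⁻¹ * mono a := by
  have h1 : (-1 : ZMod (2 * N + 1)) ≠ 0 := neg_ne_zero.2 (zmod_one_ne_zero hN)
  rw [mono, prod_act hN _ ha, wt_pred, if_neg h1, neg_add_cancel, wt_zero, wt_neg_one, mul_comm,
    mono, ← zpow_natCast, ← zpow_neg]
  congr 2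
  push_cast; ring

theorem sMap_last_a_zero (hN : 1 ≤ N) (v : Tup N K) :
    (sMap (2 * N) v).a 0 = v.a (-1) * v.a 0 := by
  have h1 : (0 : ZMod (2 * N + 1)) ≠ -1 := (neg_ne_zero.2 (zmod_one_ne_zero hN)).symm
  rw [sMap_a, natCast_two_mul, act, if_neg h1, if_pos (by simp)]

theorem xTerm_sMap (hN : 1 ≤ N) {k : ℕ} (hk : k ∈ Icc 2 (2 * N)) {v : Tup N K} (h0 : Nz v)
    (hC : C v) (h1 : Nz (sMap k v)) : xTerm (sMap k v) = xTerm v := by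
  rw [xTerm_eq hN h1 (C_sMap hN k h0 hC), xTerm_eq hN h0 hC, sMap_c]
  congr 1
  rw [mem_Icc] at hk
  by_cases h : k = 2 * N
  · subst h
    have ha := h0.1 (-1)
    rw [sMap_last_a_zero hN v, yTerm, yTerm, sMap_a, natCast_two_mul, mono_act_neg_one hN h0.1]
    simp only [sMap, mul_pow]
    field_simp
  · rw [sMap_a_zero (by rw [mem_Icc]; omega), yTerm_sMap hN (by rw [mem_Icc]; omega) h0]

theorem Qval_sMap (hN : 1 ≤ N) {k : ℕ} (hk : k ∈ Icc 2 (2 * N)) {v : Tup N K} (h0 : Nz v)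
    (hC : C v) (h1 : Nz (sMap k v)) :
    Qval (sMap k v) = Qval v * (if k = 2 * N then fac k v else 1) := by
  rw [Qval_eq, Qval_eq, evenProd_sMap hk h1, xTerm_sMap hN hk h0 hC h1, sMap_c]
  rw [mem_Icc] at hk
  split_ifs with h
  · subst h
    rw [oddProd_sMap_last hN, ← div_div, div_inv_eq_mul]
    ring
  · rw [oddProd_sMap (by rw [mem_Icc]; omega) h1, mul_one]

theorem fac_piMap {k : ℕ} (hk : k ∈ Icc 2 (2 * N)) (v : Tup N K) :
    fac (k - 1) (piMap v) = fac k v := by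
  rw [mem_Icc] at hk
  have hmu : mu v.c⁻¹ (k - 1) = mu v.c k := by
    obtain ⟨m, rfl⟩ : ∃ m, k = m + 1 := ⟨k - 1, by omega⟩
    rw [mu_succ, Nat.add_sub_cancel, mu, mu]
    split_ifs <;> simp
  have ha : (piMap v).a ((k - 1 : ℕ) : ZMod (2 * N + 1)) = v.a k := by
    simp only [piMap]
    rw [Nat.cast_sub (by omega), Nat.cast_one, sub_add_cancel]
  rw [fac, fac, ha, piMap_f (by rw [mem_Icc]; omega), Nat.sub_add_cancel (by omega)]
  change (_ * mu v.c⁻¹ _ - _) / (mu v.c⁻¹ _ - _) = _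
  rw [hmu]

theorem piMap_sMap (hN : 1 ≤ N) {k : ℕ} (hk : k ∈ Icc 2 (2 * N)) {v : Tup N K} (h0 : Nz v)
    (hC : C v) (h1 : Nz (sMap k v)) : piMap (sMap k v) = sMap (k - 1) (piMap v) := by
  have hk' := mem_Icc.1 hk
  have hk1 : k ∈ Icc 1 (2 * N) := by rw [mem_Icc]; omega
  have hk2 : k - 1 ∈ Icc 1 (2 * N) := by rw [mem_Icc]; omega
  refine Tup.ext_of (fun j => ?_) rfl rfl rfl fun j => ?_
  · have h := act_shift ((k - 1 : ℕ) : ZMod (2 * N + 1)) 1 v.a j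
    rw [Nat.cast_sub (by omega), Nat.cast_one, sub_add_cancel] at h
    rw [sMap_a, Nat.cast_sub (by omega), Nat.cast_one]
    exact h.symm
  · rw [sMap_f hk2, fac_piMap hk]
    by_cases h : j ∈ Icc 1 (2 * N - 1)
    · have h' := mem_Icc.1 h
      rw [piMap_f h, piMap_f h, sMap_f hk1]
      congr 1
      simp only [scale]
      split_ifs <;> first | rfl | omega
    by_cases h2 : j = 2 * N
    · subst h2
      rw [piMap_f_last hN, piMap_f_last hN, Qval_sMap hN hk h0 hC h1]
      congr 1
      simp only [scale]
      split_ifs <;> first | rfl | omega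
    have h3 : j ∉ Icc 1 (2 * N) := by rw [mem_Icc] at *; omega
    rw [piMap_f_of_notMem hN h3, piMap_f_of_notMem hN h3, sMap_f hk1, scale_of_notMem hk1 h3,
      scale_of_notMem hk2 h3]

theorem piMap_t0 (hN : 1 ≤ N) {v : Tup N K} (h0 : Nz v) (hC : C v) (h1 : Nz (t0 v)) :
    piMap (t0 v) = sMap (2 * N) (piMap v) := by
  obtain ⟨n0, l0, D0⟩ := t0_ne hN h1
  have hm : 2 * N ∈ Icc 1 (2 * N) := by rw [mem_Icc]; omega
  have hc := h0.2.2.1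
  have hA : v.a 0 ≠ 0 := h0.1 0
  have hO := oddProd_ne_zero h0
  have hX := xTerm_eq hN h0 hC
  have hfac : fac (2 * N) (piMap v) = den v / numLst v := by
    have ha : (piMap v).a ((2 * N : ℕ) : ZMod (2 * N + 1)) = v.a 0 := by
      simp only [piMap]
      rw [natCast_two_mul, neg_add_cancel]
    have hmu : mu (piMap v).c (2 * N) = v.c ^ 2 := by simp [mu, piMap]
    rw [fac, ha, hmu, piMap_f_last hN, Qval_eq, hX]
    have e1 : v.a 0 ^ (2 * N + 1) * v.c ^ 2 - -(v.c ^ 4 / oddProd v) *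
        (evenProd v + v.a 0 ^ (2 * N + 1) * yTerm v / v.c ^ 2) =
        v.c ^ 2 * den v / oddProd v := by
      rw [den]; field_simp; ring
    have e2 : v.c ^ 2 - v.a 0 ^ (2 * N + 1) * (-(v.c ^ 4 / oddProd v) *
        (evenProd v + v.a 0 ^ (2 * N + 1) * yTerm v / v.c ^ 2)) =
        v.c ^ 2 * numLst v / oddProd v := by
      rw [numLst]; field_simp; ring
    rw [e1, e2]
    field_simp
  have hQ : Qval (t0 v) = Qval v := by
    rw [Qval_eq, Qval_eq, xTerm_eq hN h1 (C_t0 hN h0 hC), hX, oddProd_t0 hN, evenProd_t0 hN,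
      yTerm_t0 hN h0, t0_a_zero, inv_pow]
    change -(v.c ^ 4 / _) * (_ + _ / v.c ^ 2) = _
    have key : v.c ^ 2 * evenProd v * numLst v + yTerm v * den v =
        numFst v * (v.c ^ 2 * evenProd v + v.a 0 ^ (2 * N + 1) * yTerm v) := by
      rw [numFst, numLst, den]; ring
    generalize numFst v = n at *
    generalize numLst v = l at *
    generalize den v = D at *
    generalize oddProd v = O at *
    field_simp
    linear_combination -key
  refine Tup.ext_of (fun j => ?_) rfl rfl rfl fun j => ?_
  · have h := act_shift (-1 : ZMod (2 * N + 1)) 1 v.a j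
    rw [neg_add_cancel] at h
    rw [sMap_a, natCast_two_mul]
    exact h.symm
  · rw [sMap_f hm, hfac]
    by_cases h : j ∈ Icc 1 (2 * N - 1)
    · have h' := mem_Icc.1 h
      rw [piMap_f h, piMap_f h]
      simp only [t0, scale, inv_div]
      rw [if_neg (by omega), one_mul]
      congr 1
      split_ifs <;> first | rfl | omega
    by_cases h2 : j = 2 * N
    · subst h2
      rw [piMap_f_last hN, piMap_f_last hN, hQ, scale, if_neg (by omega), if_neg (by omega),
        mul_one]
    have h3 : j ∉ Icc 1 (2 * N) := by rw [mem_Icc] at *; omega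
    rw [piMap_f_of_notMem hN h3, piMap_f_of_notMem hN h3, scale_of_notMem hm h3, mul_one]
    rw [mem_Icc] at h3
    simp only [t0]
    rw [if_neg (by omega), if_neg (by omega), mul_one, mul_one]

theorem piMap_sMap_piInv (hN : 1 ≤ N) {v : Tup N K} (h0 : Nz v) (hC : C v) (h1 : Nz (piInv v))
    (h2 : Nz (sMap 1 (piInv v))) : piMap (sMap 1 (piInv v)) = t0 v := by
  have hm : 1 ∈ Icc 1 (2 * N) := by rw [mem_Icc]; omega
  have hm1 : 1 ∈ Icc 1 (2 * N - 1) := by rw [mem_Icc]; omega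
  have hc := h0.2.2.1
  have hq := h0.2.2.2.1
  have hE := evenProd_ne_zero h0
  have hf := h0.2.2.2.2 (2 * N) (by rw [mem_Icc]; omega)
  have ha : (piInv v).a 1 = v.a 0 := by simp [piInv]
  have hS : oddProd v + yTerm v ≠ 0 := by
    have h := h1.2.2.2.2 1 hm
    intro h'
    rw [piInv_f_first hN h0, h'] at h
    simp at h
  have hfac : fac 1 (piInv v) = numFst v / den v := by
    have e1 : v.a 0 ^ (2 * N + 1) * v.c⁻¹ ^ 2 -
        -(v.c⁻¹ ^ 4 * (oddProd v + yTerm v)) / evenProd v =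
        numFst v / (v.c ^ 4 * evenProd v) := by
      rw [numFst]; field_simp; ring
    have e2 : v.c⁻¹ ^ 2 - v.a 0 ^ (2 * N + 1) *
        (-(v.c⁻¹ ^ 4 * (oddProd v + yTerm v)) / evenProd v) =
        den v / (v.c ^ 4 * evenProd v) := by
      rw [den]; field_simp; ring
    rw [fac_one, ha, piInv_f_first hN h0]
    change (_ * v.c⁻¹ ^ 2 - _) / (v.c⁻¹ ^ 2 - _) = _
    rw [e1, e2, div_div_div_cancel_right₀ (mul_ne_zero (pow_ne_zero _ hc) hE)]
  have hD : den v ≠ 0 := by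
    have h := fac_ne_zero hm h2
    rw [hfac, div_ne_zero_iff] at h
    exact h.2
  have hX : xTerm (sMap 1 (piInv v)) = v.a 0 ^ (2 * N + 1) * yTerm v := by
    rw [xTerm_eq hN h2 (C_sMap hN 1 h1 (C_piInv hC)), ← xTerm_piInv hN h0,
      xTerm_eq hN h1 (C_piInv hC), sMap_one_a_zero hN, ha, yTerm_sMap hN hm1 h1, sMap_c]
    ring
  have hQ : Qval (sMap 1 (piInv v)) = v.f (2 * N) * (numLst v / den v) := by
    have hO := oddProd_piInv hN h0
    have hO' := oddProd_ne_zero h1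
    have e1 : oddProd (piInv v) = -(v.c⁻¹ ^ 4 * (oddProd v + yTerm v)) / v.f (2 * N) := by
      rw [← hO, mul_div_cancel_right₀ _ hf]
    have key : oddProd v * numFst v + v.a 0 ^ (2 * N + 1) * yTerm v * den v =
        numLst v * (oddProd v + yTerm v) := by
      rw [numFst, numLst, den]; ring
    rw [Qval_eq, oddProd_sMap hm1 h2, evenProd_sMap_first hN, hX, hfac, evenProd_piInv, e1]
    change -(v.c⁻¹ ^ 4 / _) * _ = _
    generalize numFst v = n at *
    generalize numLst v = l at *
    generalize den v = D at *
    generalize hs : oddProd v + yTerm v = s at *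
    field_simp
    linear_combination key
  refine Tup.ext_of (fun j => ?_) ?_ (inv_inv _) rfl fun j => ?_
  · have h := act_shift (0 : ZMod (2 * N + 1)) 1 (piInv v).a j
    have e : (fun k => (piInv v).a (k + 1)) = v.a := by
      funext k; simp [piInv]
    rw [e, zero_add] at h
    simp only [piMap, t0, sMap_a, Nat.cast_one]
    exact h.symm
  · simp only [piMap, piInv, sMap, t0]; field_simp
  · by_cases h : j ∈ Icc 1 (2 * N - 1)
    · have h' := mem_Icc.1 h
      rw [piMap_f h, sMap_f hm, hfac, piInv_f (by rw [mem_Icc]; omega), Nat.add_sub_cancel]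
      simp only [t0, scale]
      rw [if_neg (c := j = 2 * N) (by omega), mul_one]
      congr 1
      split_ifs <;> first | rfl | omega
    by_cases h2 : j = 2 * N
    · subst h2
      rw [piMap_f_last hN, hQ]
      simp only [t0, if_true]
      rw [if_neg (by omega), one_mul]
    have h3 : j ∉ Icc 1 (2 * N) := by rw [mem_Icc] at *; omega
    rw [piMap_f_of_notMem hN h3, sMap_f hm, piInv_f_of_notMem hN h3, scale_of_notMem hm h3,
      mul_one]
    rw [mem_Icc] at h3
    simp only [t0]
    rw [if_neg (by omega), if_neg (by omega), mul_one, mul_one]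

theorem okChain.nz {l : List (Tup N K → Tup N K)} {v : Tup N K} (h : okChain l v) : Nz v := by
  cases l with
  | nil => exact h
  | cons => exact h.1

/-- The maps `s_i`, `i ∈ ℤ/(2N+1)ℤ`, with `s₀` in the closed form `t0`. -/
def cycMap (i : ZMod (2 * N + 1)) (v : Tup N K) : Tup N K :=
  if i = 0 then t0 v else sMap i.val v

theorem cycMap_zero (v : Tup N K) : cycMap 0 v = t0 v := if_pos rfl

theorem cycMap_of_ne {i : ZMod (2 * N + 1)} (hi : i ≠ 0) (v : Tup N K) :
    cycMap i v = sMap i.val v := if_neg hi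

theorem val_mem_Icc {i : ZMod (2 * N + 1)} (hi : i ≠ 0) : i.val ∈ Icc 1 (2 * N) := by
  have h1 := ZMod.val_lt i
  have h2 : i.val ≠ 0 := (ZMod.val_ne_zero i).2 hi
  rw [mem_Icc]
  omega

theorem val_eq_of_natCast_eq {i : ZMod (2 * N + 1)} {m : ℕ} (hm : m ≤ 2 * N)
    (h : (m : ZMod (2 * N + 1)) = i) : i.val = m := by
  rw [← h, ZMod.val_natCast_of_lt (by omega)]

theorem sFam_spec (hN : 1 ≤ N) {i : ZMod (2 * N + 1)} {l : List (Tup N K → Tup N K)}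
    {v : Tup N K} (hC : C v) (h : okChain (sL i ++ l) v) :
    sFam i v = cycMap i v ∧ C (cycMap i v) ∧ okChain l (cycMap i v) := by
  by_cases hi : i = 0
  · subst hi
    simp only [sFam, sL, if_pos, apChain, cycMap] at h ⊢
    obtain ⟨h0, h1, h2, h3⟩ := h
    rw [piMap_sMap_piInv hN h0 hC h1 h2] at h3 ⊢
    exact ⟨rfl, C_t0 hN h0 hC, h3⟩
  · simp only [sFam, sL, if_neg hi, apChain, cycMap] at h ⊢
    exact ⟨trivial, C_sMap hN _ h.1 hC, h.2⟩

theorem cycMap_cycMap (hN : 1 ≤ N) (i : ZMod (2 * N + 1)) {v : Tup N K} (h0 : Nz v)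
    (h1 : Nz (cycMap i v)) : cycMap i (cycMap i v) = v := by
  by_cases hi : i = 0
  · subst hi
    rw [cycMap_zero] at h1
    rw [cycMap_zero, cycMap_zero, t0_t0 hN h0 h1]
  · rw [cycMap_of_ne hi] at h1
    rw [cycMap_of_ne hi, cycMap_of_ne hi, sMap_sMap hN (val_mem_Icc hi) h0 h1]

theorem w1_cycMap_w1 (hN : 1 ≤ N) (k : ZMod (2 * N + 1)) {v : Tup N K} (h0 : Nz v) (hC : C v) :
    w1 (cycMap k (w1 v)) = cycMap (-k) v := by
  by_cases hk : k = 0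
  · subst hk
    rw [neg_zero, cycMap_zero, cycMap_zero, w1_t0_w1 hN h0 hC]
  · rw [cycMap_of_ne hk, cycMap_of_ne (neg_ne_zero.2 hk), w1_sMap (val_mem_Icc hk) h0,
      ZMod.neg_val, if_neg hk]

theorem cycMap_w1 (hN : 1 ≤ N) (k : ZMod (2 * N + 1)) {v : Tup N K} (h0 : Nz v) (hC : C v) :
    cycMap k (w1 v) = w1 (cycMap (-k) v) := by
  have hq : (cycMap k (w1 v)).q ≠ 0 := by
    have : (cycMap k (w1 v)).q = v.q⁻¹ := by
      unfold cycMap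
      split_ifs <;> rfl
    rw [this]
    exact inv_ne_zero h0.2.2.2.1
  rw [← w1_cycMap_w1 hN k h0 hC, w1_w1 hq]

theorem cycMap_zero_braid (hN : 1 ≤ N) {v : Tup N K} (h0 : Nz v) (a1 : Nz (cycMap 1 v))
    (a2 : Nz (cycMap 0 (cycMap 1 v))) (b1 : Nz (cycMap 0 v)) (b2 : Nz (cycMap 1 (cycMap 0 v))) :
    cycMap 0 (cycMap 1 (cycMap 0 v)) = cycMap 1 (cycMap 0 (cycMap 1 v)) := by
  have hv : (1 : ZMod (2 * N + 1)).val = 1 :=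
    val_eq_of_natCast_eq (by omega) Nat.cast_one
  have h : ∀ u : Tup N K, cycMap 1 u = sMap 1 u := fun u => by
    rw [cycMap_of_ne (zmod_one_ne_zero hN), hv]
  simp only [h, cycMap_zero] at *
  exact t0_braid hN h0 a1 a2 b1 b2

theorem cycMap_neg_one_braid (hN : 1 ≤ N) {v : Tup N K} (h0 : Nz v) (hC : C v)
    (hCa : C (cycMap (-1) v)) (hCa' : C (cycMap 0 (cycMap (-1) v))) (hCb : C (cycMap 0 v))
    (hCb' : C (cycMap (-1) (cycMap 0 v)))
    (a1 : Nz (cycMap (-1) v)) (a2 : Nz (cycMap 0 (cycMap (-1) v)))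
    (a3 : Nz (cycMap (-1) (cycMap 0 (cycMap (-1) v))))
    (b1 : Nz (cycMap 0 v)) (b2 : Nz (cycMap (-1) (cycMap 0 v)))
    (b3 : Nz (cycMap 0 (cycMap (-1) (cycMap 0 v)))) :
    cycMap (-1) (cycMap 0 (cycMap (-1) v)) = cycMap 0 (cycMap (-1) (cycMap 0 v)) := by
  have e0 {u : Tup N K} (h : Nz u) (hu : C u) : cycMap 0 (w1 u) = w1 (cycMap 0 u) := by
    rw [cycMap_w1 hN 0 h hu, neg_zero]
  have e1 {u : Tup N K} (h : Nz u) (hu : C u) : cycMap 1 (w1 u) = w1 (cycMap (-1) u) :=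
    cycMap_w1 hN 1 h hu
  have h := cycMap_zero_braid hN (Nz_w1 h0)
    (by rw [e1 h0 hC]; exact Nz_w1 a1)
    (by rw [e1 h0 hC, e0 a1 hCa]; exact Nz_w1 a2)
    (by rw [e0 h0 hC]; exact Nz_w1 b1)
    (by rw [e0 h0 hC, e1 b1 hCb]; exact Nz_w1 b2)
  rw [e0 h0 hC, e1 b1 hCb, e0 b2 hCb', e1 h0 hC, e0 a1 hCa, e1 a2 hCa'] at h
  rw [← w1_w1 a3.2.2.2.1, ← h, w1_w1 b3.2.2.2.1]

theorem sFam_sFam (hN : 1 ≤ N) (i : ZMod (2 * N + 1)) {v : Tup N K} (hC : C v)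
    (h : okChain (sL i ++ sL i) v) : sFam i (sFam i v) = v := by
  obtain ⟨e1, hC1, h1⟩ := sFam_spec hN hC h
  rw [← List.append_nil (sL i)] at h1
  obtain ⟨e2, -, -⟩ := sFam_spec hN hC1 h1
  rw [e1, e2, cycMap_cycMap hN i h.nz h1.nz]

theorem sFam_braid (hN : 1 ≤ N) (i : ZMod (2 * N + 1)) {v : Tup N K} (hC : C v)
    (ha : okChain (sL i ++ sL (i + 1) ++ sL i) v)
    (hb : okChain (sL (i + 1) ++ sL i ++ sL (i + 1)) v) :
    sFam i (sFam (i + 1) (sFam i v)) = sFam (i + 1) (sFam i (sFam (i + 1) v)) := by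
  rw [← List.append_nil (_ ++ _), List.append_assoc, List.append_assoc] at ha hb
  obtain ⟨ea1, hCa1, ha1⟩ := sFam_spec hN hC ha
  obtain ⟨ea2, hCa2, ha2⟩ := sFam_spec hN hCa1 ha1
  obtain ⟨ea3, hCa3, ha3⟩ := sFam_spec hN hCa2 ha2
  obtain ⟨eb1, hCb1, hb1⟩ := sFam_spec hN hC hb
  obtain ⟨eb2, hCb2, hb2⟩ := sFam_spec hN hCb1 hb1
  obtain ⟨eb3, hCb3, hb3⟩ := sFam_spec hN hCb2 hb2
  rw [ea1, ea2, ea3, eb1, eb2, eb3]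
  replace ha := ha.nz
  replace ha1 := ha1.nz
  replace ha2 := ha2.nz
  replace hb1 := hb1.nz
  replace hb2 := hb2.nz
  clear ea1 ea2 ea3 eb1 eb2 eb3
  by_cases hi : i = 0
  · subst hi
    rw [zero_add] at *
    exact cycMap_zero_braid hN ha hb1 hb2 ha1 ha2
  by_cases hi' : i + 1 = 0
  · obtain rfl := eq_neg_of_add_eq_zero_left hi'
    rw [neg_add_cancel] at *
    exact cycMap_neg_one_braid hN ha hC hCa1 hCa2 hCb1 hCb2 ha1 ha2 ha3 hb1 hb2 hb3
  have hm := mem_Icc.1 (val_mem_Icc hi)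
  have hm' : i.val ≠ 2 * N := fun h => hi' <| by
    rw [← ZMod.natCast_zmod_val i, h, natCast_two_mul, neg_add_cancel]
  have hv : (i + 1).val = i.val + 1 :=
    val_eq_of_natCast_eq (by omega) (by rw [Nat.cast_add, ZMod.natCast_zmod_val, Nat.cast_one])
  have h' : ∀ u : Tup N K, cycMap (i + 1) u = sMap (i.val + 1) u := fun u => by
    rw [cycMap_of_ne hi', hv]
  simp only [h', cycMap_of_ne hi] at *
  exact sMap_braid hN (mem_Icc.2 (by omega)) ha ha1 ha2 ha3 hb1 hb2 hb3

theorem t0_comm_cycMap (hN : 1 ≤ N) {j : ZMod (2 * N + 1)} (h : j ≠ 0) (h1 : j ≠ 1) (h2 : j ≠ -1)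
    {v : Tup N K} (h0 : Nz v) (hj : Nz (cycMap j v)) :
    t0 (cycMap j v) = cycMap j (t0 v) := by
  rw [cycMap_of_ne h] at hj
  rw [cycMap_of_ne h, cycMap_of_ne h]
  have hm := mem_Icc.1 (val_mem_Icc h)
  have hv1 : j.val ≠ 1 := fun e => h1 <| by
    rw [← ZMod.natCast_zmod_val j, e, Nat.cast_one]
  have hv2 : j.val ≠ 2 * N := fun e => h2 <| by
    rw [← ZMod.natCast_zmod_val j, e, natCast_two_mul]
  exact t0_comm hN (mem_Icc.2 (by omega)) h0 hj

theorem sFam_comm (hN : 1 ≤ N) {i j : ZMod (2 * N + 1)} (h : j ≠ i) (h1 : j ≠ i + 1)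
    (h2 : j ≠ i - 1) {v : Tup N K} (hC : C v) (ha : okChain (sL j ++ sL i) v)
    (hb : okChain (sL i ++ sL j) v) : sFam i (sFam j v) = sFam j (sFam i v) := by
  obtain ⟨ea1, hCa1, ha1⟩ := sFam_spec hN hC ha
  obtain ⟨eb1, hCb1, hb1⟩ := sFam_spec hN hC hb
  rw [← List.append_nil (sL _)] at ha1 hb1
  rw [ea1, eb1, (sFam_spec hN hCa1 ha1).1, (sFam_spec hN hCb1 hb1).1]
  by_cases hi : i = 0
  · subst hi
    rw [cycMap_zero, cycMap_zero]
    exact t0_comm_cycMap hN h (by rwa [zero_add] at h1) (by rwa [zero_sub] at h2) ha.nz ha1.nz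
  by_cases hj : j = 0
  · subst hj
    rw [cycMap_zero, cycMap_zero]
    exact (t0_comm_cycMap hN hi (fun e => h2 (by rw [e, sub_self]))
      (fun e => h1 (by rw [e, neg_add_cancel])) ha.nz hb1.nz).symm
  rw [cycMap_of_ne hi, cycMap_of_ne hj, cycMap_of_ne hj, cycMap_of_ne hi]
  refine sMap_comm (val_mem_Icc hi) (val_mem_Icc hj) ?_ v
  have n0 : j.val ≠ i.val := fun e => h (ZMod.val_injective _ e)
  have n1 : j.val ≠ i.val + 1 := fun e => h1 <| by
    rw [← ZMod.natCast_zmod_val j, e, Nat.cast_add, ZMod.natCast_zmod_val, Nat.cast_one]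
  have n2 : i.val ≠ j.val + 1 := fun e => h2 <| by
    rw [← ZMod.natCast_zmod_val i, e, Nat.cast_add, ZMod.natCast_zmod_val, Nat.cast_one,
      add_sub_cancel_right]
  omega

theorem w1_sFam_w1 (hN : 1 ≤ N) (k : ZMod (2 * N + 1)) {v : Tup N K} (hC : C v)
    (ha : okChain ([w1] ++ sL k ++ [w1]) v) (hb : okChain (sL (-k)) v) :
    w1 (sFam k (w1 v)) = sFam (-k) v := by
  rw [List.append_assoc] at ha
  rw [← List.append_nil (sL _)] at hb
  rw [(sFam_spec hN (C_w1 hC) ha.2).1, (sFam_spec hN hC hb).1, w1_cycMap_w1 hN k hb.nz hC]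

/-- The relations of the extended affine Weyl group of type `(A_{2N} ⋊ A₁)⁽¹⁾` for the
birational representation coming from the `(1,…,1)`-periodic reduction with `n = 2N+1`:
each relation holds at every tuple (subject to `a₀a₁···a_{2N} = q`) at which all rational
expressions arising in the indicated composites are defined and nonzero. -/
theorem weyl_relations_A2N_A1 (hN : 1 ≤ N) :
    -- (1)
    (∀ i ∈ Icc 1 (2 * N), ∀ v : Tup N K, C v →
      okChain [sMap i, sMap i] v → sMap i (sMap i v) = v) ∧
    -- (2)
    (∀ i ∈ Icc 1 (2 * N - 1), ∀ v : Tup N K, C v →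
      okChain [sMap i, sMap (i + 1), sMap i] v →
      okChain [sMap (i + 1), sMap i, sMap (i + 1)] v →
      sMap i (sMap (i + 1) (sMap i v)) = sMap (i + 1) (sMap i (sMap (i + 1) v))) ∧
    -- (3)
    (∀ i ∈ Icc 1 (2 * N), ∀ j ∈ Icc 1 (2 * N), (i + 2 ≤ j ∨ j + 2 ≤ i) →
      ∀ v : Tup N K, C v → okChain [sMap j, sMap i] v → okChain [sMap i, sMap j] v →
      sMap i (sMap j v) = sMap j (sMap i v)) ∧
    -- (4)
    (∀ v : Tup N K, C v → okChain [w1, w1] v → w1 (w1 v) = v) ∧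
    -- (5)
    (∀ k ∈ Icc 1 (2 * N), ∀ v : Tup N K, C v →
      okChain [w1, sMap k, w1] v → okChain [sMap (2 * N + 1 - k)] v →
      w1 (sMap k (w1 v)) = sMap (2 * N + 1 - k) v) ∧
    -- (6)
    (∀ k ∈ Icc 2 (2 * N), ∀ v : Tup N K, C v →
      okChain [piInv, sMap k, piMap] v → okChain [sMap (k - 1)] v →
      piMap (sMap k (piInv v)) = sMap (k - 1) v) ∧
    (∀ v : Tup N K, C v →
      okChain [piInv, piInv, sMap 1, piMap, piMap] v → okChain [sMap (2 * N)] v →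
      piMap (piMap (sMap 1 (piInv (piInv v)))) = sMap (2 * N) v) ∧
    -- (7)
    (∀ v : Tup N K, C v → okChain [w1, piMap, w1, piMap] v →
      piMap (w1 (piMap (w1 v))) = v) ∧
    -- (8): the relations (1), (2), (3) and (5) with indices read modulo 2N+1
    (∀ i : ZMod (2 * N + 1), ∀ v : Tup N K, C v → okChain (sL i ++ sL i) v →
      sFam i (sFam i v) = v) ∧
    (∀ i : ZMod (2 * N + 1), ∀ v : Tup N K, C v →
      okChain (sL i ++ sL (i + 1) ++ sL i) v →
      okChain (sL (i + 1) ++ sL i ++ sL (i + 1)) v →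
      sFam i (sFam (i + 1) (sFam i v)) = sFam (i + 1) (sFam i (sFam (i + 1) v))) ∧
    (∀ i j : ZMod (2 * N + 1), j ≠ i → j ≠ i + 1 → j ≠ i - 1 →
      ∀ v : Tup N K, C v → okChain (sL j ++ sL i) v → okChain (sL i ++ sL j) v →
      sFam i (sFam j v) = sFam j (sFam i v)) ∧
    (∀ k : ZMod (2 * N + 1), ∀ v : Tup N K, C v →
      okChain ([w1] ++ sL k ++ [w1]) v → okChain (sL (-k)) v →
      w1 (sFam k (w1 v)) = sFam (-k) v) := by
  refine ⟨?_, ?_, ?_, ?_, ?_, ?_, ?_, ?_, fun i v hC => sFam_sFam hN i hC,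
    fun i v hC => sFam_braid hN i hC, fun i j h h1 h2 v hC => sFam_comm hN h h1 h2 hC,
    fun k v hC => w1_sFam_w1 hN k hC⟩
  · rintro i hi v - ⟨h0, h1, -⟩
    exact sMap_sMap hN hi h0 h1
  · rintro i hi v - ⟨h0, h1, h2, h3⟩ ⟨-, h1', h2', h3'⟩
    exact sMap_braid hN hi h0 h1 h2 h3 h1' h2' h3'
  · intro i hi j hj hij v _ _ _
    exact sMap_comm hi hj hij v
  · rintro v - ⟨h0, -⟩
    exact w1_w1 h0.2.2.2.1
  · rintro k hk v - ⟨h0, -⟩ -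
    exact w1_sMap hk h0
  · rintro k hk v hC ⟨h0, h1, h2, -⟩ -
    rw [piMap_sMap hN hk h1 (C_piInv hC) h2, piMap_piInv hN h0 h1]
  · rintro v hC ⟨h0, h1, h2, h3, h4, -⟩ -
    rw [piMap_sMap_piInv hN h1 (C_piInv hC) h2 h3] at h4 ⊢
    rw [piMap_t0 hN h1 (C_piInv hC) h4, piMap_piInv hN h0 h1]
  · rintro v hC ⟨h0, -, -, h3, -⟩
    rw [w1_piMap_w1 hN h0 hC] at h3 ⊢
    exact piMap_piInv hN h0 h3

end WeylA2NA1
end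

section
/- Fix an integer N ≥ 1 and let K be a field. Let π be the map on tuples (a0,…,a_{2N}, b, c, q, f1,…,f_{2N}) given by π(a0,…,a_{2N}, b, c, q, f1,…,f_{2N}) = (a1,…,a_{2N}, a0, q·b, c^{−1}, q, f2,…,f_{2N}, Q) with Q = −(c^4/∏_{k=1}^N f_{2k−1})·(∏_{k=1}^N f_{2k} + q^{2N}·a0·b/[(∏_{k=1}^{2N−1} a_k^{2N−k})·c]). Let u = (a0,…,a_{2N}, b, c, q, g1,…,g_{2N}) have all entries nonzero with a0·a1···a_{2N} = q, and suppose π can be applied 2N+1 times to u with all intermediate entries defined and nonzero; write π^{2N+1}(u) = (a0,…,a_{2N}, b', c', q, f1,…,f_{2N}), where b' = q^{2N+1}·b and c' = c^{−1}. Then, assuming all denominators below are nonzero: a_i^{2N+1}·(g_i·f_i − 1)/(a_i^{2N+1} − (c')^{2(−1)^i}·f_i) = (g_{i+1}·f_{i+1} − 1)/(1 − a_{i+1}^{2N+1}·(c')^{2(−1)^i}·g_{i+1}) for all i = 1,…,2N−1, and a_{2N}^{2N+1}·(g_{2N}·f_{2N} − 1)/(a_{2N}^{2N+1} − (c')^2·f_{2N})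 = (∏_{k=1}^{2N} a_k^k)·b'·c'/∏_{k=1}^N f_{2k−1}. -/
open Finset

namespace QP2NA4

/-- A tuple `(a₀, …, a_{2N}, b, c, q, f₁, …, f_{2N})`: the `a`-components are indexed
cyclically by `ZMod (2N+1)` and the `f`-components by the natural numbers `1, …, 2N`. -/
structure Tup (N : ℕ) (K : Type*) where
  a : ZMod (2 * N + 1) → K
  b : K
  c : K
  q : K
  f : ℕ → K

variable {N : ℕ} {K : Type*} [Field K]

/-- All entries of the tuple are nonzero. -/
def Nz (v : Tup N K) : Prop :=
  (∀ j : ZMod (2 * N + 1), v.a j ≠ 0) ∧ v.b ≠ 0 ∧ v.c ≠ 0 ∧ v.q ≠ 0 ∧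
    ∀ j ∈ Icc 1 (2 * N), v.f j ≠ 0

/-- The last `f`-component of `π`. -/
def Qval (v : Tup N K) : K :=
  -(v.c ^ 4 / ∏ k ∈ Icc 1 N, v.f (2 * k - 1)) *
    ((∏ k ∈ Icc 1 N, v.f (2 * k)) +
      v.q ^ (2 * N) * v.a 0 * v.b
        / ((∏ k ∈ Icc 1 (2 * N - 1), v.a k ^ (2 * N - k)) * v.c))

/-- The map `π`. -/
def piMap (v : Tup N K) : Tup N K where
  a := fun j => v.a (j + 1)
  b := v.q * v.b
  c := v.c⁻¹
  q := v.q
  f := fun j =>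
    if 1 ≤ j ∧ j ≤ 2 * N - 1 then v.f (j + 1) else if j = 2 * N then Qval v else v.f j

/-- The product of the odd-indexed `f`-components. -/
def oddProd (v : Tup N K) : K := ∏ k ∈ Icc 1 N, v.f (2 * k - 1)

/-- The weighted product of the `a`-components in the denominator of `Qval`. -/
def weight (v : Tup N K) : K := ∏ k ∈ Icc 1 (2 * N - 1), v.a k ^ (2 * N - k)

/-- The inhomogeneous term of `Qval`. -/
def source (v : Tup N K) : K := v.q ^ (2 * N) * v.a 0 * v.b / (weight v * v.c)

lemma piMap_f_of_lt (v : Tup N K) {j : ℕ} (h₁ : 1 ≤ j) (h₂ : j < 2 * N) :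
    (piMap v).f j = v.f (j + 1) :=
  if_pos ⟨h₁, by omega⟩

lemma piMap_f_last (hN : 1 ≤ N) (v : Tup N K) : (piMap v).f (2 * N) = Qval v := by
  have h : ¬(1 ≤ 2 * N ∧ 2 * N ≤ 2 * N - 1) := by omega
  simp only [piMap, if_neg h, if_true]

lemma iterate_piMap_f (u : Tup N K) (k : ℕ) {i : ℕ} (h₁ : 1 ≤ i) (h₂ : i + k ≤ 2 * N) :
    (piMap^[k] u).f i = u.f (i + k) := by
  induction k generalizing i with
  | zero => rfl
  | succ k ih =>
    rw [Function.iterate_succ_apply', piMap_f_of_lt _ h₁ (by omega), ih (by omega) (by omega)]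
    congr 1
    omega

lemma iterate_piMap_a (u : Tup N K) (k : ℕ) (j : ZMod (2 * N + 1)) :
    (piMap^[k] u).a j = u.a (j + k) := by
  induction k generalizing j with
  | zero => simp
  | succ k ih =>
    rw [Function.iterate_succ_apply']
    change (piMap^[k] u).a (j + 1) = _
    rw [ih]
    congr 1
    push_cast
    ring

lemma iterate_piMap_q (u : Tup N K) (k : ℕ) : (piMap^[k] u).q = u.q := by
  induction k with
  | zero => rfl
  | succ k ih => rw [Function.iterate_succ_apply']; exact ih

lemma iterate_piMap_b (u : Tup N K) (k : ℕ) : (piMap^[k] u).b = u.q ^ k * u.b := by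
  induction k with
  | zero => simp
  | succ k ih =>
    rw [Function.iterate_succ_apply']
    change (piMap^[k] u).q * (piMap^[k] u).b = _
    rw [ih, iterate_piMap_q, pow_succ']
    ring

lemma iterate_piMap_c (u : Tup N K) (k : ℕ) : (piMap^[k] u).c = u.c ^ ((-1 : ℤ) ^ k) := by
  induction k with
  | zero => simp
  | succ k ih =>
    rw [Function.iterate_succ_apply']
    change ((piMap^[k] u).c)⁻¹ = _
    rw [ih, ← zpow_neg, pow_succ]
    simp

lemma iterate_piMap_f_eq_Qval (hN : 1 ≤ N) (u : Tup N K) {i : ℕ} (h₁ : 1 ≤ i)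
    (h₂ : i ≤ 2 * N) : (piMap^[2 * N + 1] u).f i = Qval (piMap^[i] u) := by
  have h : 2 * N + 1 = (2 * N - i) + (i + 1) := by omega
  rw [h, Function.iterate_add_apply, iterate_piMap_f _ _ h₁ (by omega),
    show i + (2 * N - i) = 2 * N by omega, Function.iterate_succ_apply', piMap_f_last hN]

lemma oddProd_piMap (v : Tup N K) : oddProd (piMap v) = ∏ k ∈ Icc 1 N, v.f (2 * k) := by
  refine prod_congr rfl fun k hk => ?_
  obtain ⟨h₁, h₂⟩ := mem_Icc.mp hk
  rw [piMap_f_of_lt v (by omega) (by omega)]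
  congr 1
  omega

lemma oddProd_mul_Qval (v : Tup N K) (hv : oddProd v ≠ 0) :
    oddProd v * Qval v = -v.c ^ 4 * (oddProd (piMap v) + source v) := by
  rw [oddProd_piMap]
  change oddProd v * (-(v.c ^ 4 / oddProd v) * (_ + source v)) = _
  field_simp

lemma oddProd_piMap_piMap_mul (hN : 1 ≤ N) (v : Tup N K) :
    oddProd (piMap (piMap v)) * v.f 1 = oddProd v * Qval v := by
  obtain ⟨M, rfl⟩ : ∃ M, N = M + 1 := ⟨N - 1, by omega⟩
  have hIcc : ∀ g : ℕ → K, ∏ k ∈ Icc 1 (M + 1), g k = ∏ m ∈ range (M + 1), g (m + 1) :=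
    fun g => by
      rw [← Ico_add_one_right_eq_Icc, prod_Ico_eq_prod_range]
      simp only [add_comm, add_tsub_cancel_left]
  rw [oddProd_piMap, oddProd, hIcc, hIcc, prod_range_succ, piMap_f_last hN, prod_range_succ',
    mul_right_comm]
  congr 2
  refine prod_congr rfl fun m hm => ?_
  have := mem_range.mp hm
  rw [piMap_f_of_lt v (by omega) (by omega)]
  congr 1

lemma prod_pow_shift (s : ℕ → K) (M : ℕ) :
    (∏ m ∈ range M, s (m + 1) ^ (M - m)) * s 0 ^ (M + 1)
      = (∏ m ∈ range M, s m ^ (M - m)) * ∏ m ∈ range (M + 1), s m := by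
  have h₁ : ∏ m ∈ range (M + 1), s m ^ (M + 1 - m)
      = (∏ m ∈ range M, s (m + 1) ^ (M - m)) * s 0 ^ (M + 1) := by
    rw [prod_range_succ']
    simp
  have h₂ : ∏ m ∈ range (M + 1), s m ^ (M - m) = ∏ m ∈ range M, s m ^ (M - m) := by
    rw [prod_range_succ]
    simp
  rw [← h₁, ← h₂, ← prod_mul_distrib]
  refine prod_congr rfl fun m hm => ?_
  rw [← pow_succ]
  congr 1
  have := mem_range.mp hm
  omega

lemma weight_eq_prod_range (v : Tup N K) :
    weight v = ∏ m ∈ range (2 * N - 1), v.a (m + 1 : ℕ) ^ (2 * N - 1 - m) := by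
  rw [weight, ← Ico_add_one_right_eq_Icc, prod_Ico_eq_prod_range]
  refine prod_congr rfl fun m _ => ?_
  rw [add_comm 1 m, Nat.sub_sub, add_comm m 1]

lemma prod_range_a_eq_prod_univ (v : Tup N K) :
    ∏ k ∈ range (2 * N + 1), v.a k = ∏ j, v.a j := by
  rw [prod_range]
  refine prod_congr rfl fun j _ => ?_
  congr 1
  exact Fin.cast_val_eq_self j

lemma prod_range_iterate_piMap_a (u : Tup N K) (k : ℕ) :
    ∏ j ∈ range (2 * N + 1), (piMap^[k] u).a j = ∏ j ∈ range (2 * N + 1), u.a j := by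
  rw [prod_range_a_eq_prod_univ, prod_range_a_eq_prod_univ]
  simp only [iterate_piMap_a]
  exact Equiv.prod_comp (Equiv.addRight (k : ZMod (2 * N + 1))) u.a

lemma weight_piMap_mul (hN : 1 ≤ N) (v : Tup N K)
    (hq : ∏ k ∈ range (2 * N + 1), v.a k = v.q) :
    weight (piMap v) * v.a 1 ^ (2 * N) * v.a 0 = weight v * v.q := by
  have h := prod_pow_shift (fun m : ℕ => v.a (m + 1 : ℕ)) (2 * N - 1)
  rw [Nat.sub_add_cancel (by omega : 1 ≤ 2 * N)] at h
  rw [← hq, prod_range_succ', weight_eq_prod_range v, weight_eq_prod_range (piMap v),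
    ← mul_assoc, ← h]
  simp [piMap]

lemma weight_ne_zero {v : Tup N K} (hv : Nz v) : weight v ≠ 0 :=
  prod_ne_zero_iff.mpr fun k _ => pow_ne_zero _ (hv.1 k)

lemma oddProd_ne_zero {v : Tup N K} (hv : Nz v) : oddProd v ≠ 0 := by
  refine prod_ne_zero_iff.mpr fun k hk => hv.2.2.2.2 _ ?_
  simp only [mem_Icc] at hk ⊢
  omega

lemma source_piMap (hN : 1 ≤ N) {v : Tup N K} (hv : Nz v) (hv' : Nz (piMap v))
    (hq : ∏ k ∈ range (2 * N + 1), v.a k = v.q) :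
    source (piMap v) = v.a 1 ^ (2 * N + 1) * v.c ^ 2 * source v := by
  have hw := weight_piMap_mul hN v hq
  have h₁ := weight_ne_zero hv
  have h₂ := weight_ne_zero hv'
  obtain ⟨-, -, hc, -, -⟩ := hv
  have ha : (piMap v).a 0 = v.a 1 := by simp [piMap]
  rw [source, source, ha]
  change v.q ^ (2 * N) * v.a 1 * (v.q * v.b) / (weight (piMap v) * v.c⁻¹) = _
  field_simp
  linear_combination (-v.a 1 * v.b * v.q ^ (2 * N) : K) * hw

lemma evolution_of_relations {A c r p₁ p₂ f Q : K} (hc : c ≠ 0) (hp₁ : p₁ ≠ 0)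
    (hp₂ : p₂ ≠ 0) (hf : p₂ * f = -c ^ 4 * (p₁ + r))
    (hQ : p₁ * Q = -(c⁻¹) ^ 4 * (p₂ + A * c ^ 2 * r)) :
    (A - c ^ 2 * Q ≠ 0 → A * (f * Q - 1) / (A - c ^ 2 * Q) = A * c ^ 2 * r / p₂) ∧
    (1 - A * (c⁻¹) ^ 2 * f ≠ 0 → (f * Q - 1) / (1 - A * (c⁻¹) ^ 2 * f) = r / p₁) := by
  obtain rfl : f = -c ^ 4 * (p₁ + r) / p₂ := by rw [eq_div_iff hp₂, ← hf, mul_comm]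
  obtain rfl : Q = -(c⁻¹) ^ 4 * (p₂ + A * c ^ 2 * r) / p₁ := by
    rw [eq_div_iff hp₁, ← hQ, mul_comm]
  constructor <;> intro hd
  · rw [div_eq_div_iff hd hp₂]
    field_simp
    ring
  · rw [div_eq_div_iff hd hp₁]
    field_simp
    ring

lemma evolution_step (hN : 1 ≤ N) {v : Tup N K} (hv : Nz v) (hv₁ : Nz (piMap v))
    (hv₂ : Nz (piMap (piMap v))) (hq : ∏ k ∈ range (2 * N + 1), v.a k = v.q) :
    (v.a 1 ^ (2 * N + 1) - v.c ^ 2 * Qval (piMap v) ≠ 0 →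
      v.a 1 ^ (2 * N + 1) * (v.f 1 * Qval (piMap v) - 1)
          / (v.a 1 ^ (2 * N + 1) - v.c ^ 2 * Qval (piMap v))
        = source (piMap v) / oddProd (piMap (piMap v))) ∧
    (1 - v.a 1 ^ (2 * N + 1) * (v.c⁻¹) ^ 2 * v.f 1 ≠ 0 →
      (v.f 1 * Qval (piMap v) - 1) / (1 - v.a 1 ^ (2 * N + 1) * (v.c⁻¹) ^ 2 * v.f 1)
        = source v / oddProd (piMap v)) := by
  have hs := source_piMap hN hv hv₁ hq
  have hQ := oddProd_mul_Qval (piMap v) (oddProd_ne_zero hv₁)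
  have hf := (oddProd_piMap_piMap_mul hN v).trans (oddProd_mul_Qval v (oddProd_ne_zero hv))
  rw [hs] at hQ ⊢
  exact evolution_of_relations hv.2.2.1 (oddProd_ne_zero hv₁) (oddProd_ne_zero hv₂) hf hQ

lemma source_iterate_two_mul (hN : 1 ≤ N) {u : Tup N K} (hu : Nz (piMap^[2 * N] u))
    (hq : ∏ k ∈ range (2 * N + 1), u.a k = u.q) :
    source (piMap^[2 * N] u)
      = (∏ k ∈ Icc 1 (2 * N), u.a k ^ k) * (u.q ^ (2 * N + 1) * u.b) * (u.c)⁻¹ := by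
  have hw := weight_ne_zero hu
  have hc : u.c ≠ 0 := by
    have := hu.2.2.1
    rw [iterate_piMap_c] at this
    simpa using this
  have key : weight (piMap^[2 * N] u) * ((∏ k ∈ Icc 1 (2 * N), u.a k ^ k) * u.q)
      = u.q ^ (2 * N) * u.a (2 * N : ℕ) := by
    have hw' : weight (piMap^[2 * N] u)
        = ∏ m ∈ range (2 * N), u.a m ^ (2 * N - 1 - m) := by
      rw [weight_eq_prod_range,
        show range (2 * N) = range (2 * N - 1 + 1) by rw [Nat.sub_add_cancel (by omega)],
        prod_range_succ, Nat.sub_self, pow_zero, mul_one]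
      refine prod_congr rfl fun m _ => ?_
      rw [iterate_piMap_a, ← Nat.cast_add, show m + 1 + 2 * N = m + (2 * N + 1) by ring,
        Nat.cast_add, ZMod.natCast_self, add_zero]
    have hI : ∏ k ∈ Icc 1 (2 * N), u.a k ^ k = ∏ k ∈ range (2 * N + 1), u.a k ^ k := by
      rw [range_eq_Ico, prod_eq_prod_Ico_succ_bot (by omega), pow_zero, one_mul, zero_add,
        Ico_add_one_right_eq_Icc]
    rw [hw', hI, prod_range_succ, ← mul_assoc, ← mul_assoc, ← prod_mul_distrib,
      prod_congr rfl (g := fun m : ℕ => u.a m ^ (2 * N - 1)) fun m hm => by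
        rw [← pow_add]
        congr 1
        have := mem_range.mp hm
        omega, prod_pow]
    rw [prod_range_succ] at hq
    obtain ⟨M, hM⟩ : ∃ M, 2 * N = M + 1 := ⟨2 * N - 1, by omega⟩
    rw [← hq]
    simp only [show 2 * N - 1 = M by omega]
    generalize ∏ x ∈ range (2 * N), u.a x = y
    generalize u.a (2 * N : ℕ) = z
    rw [hM]
    ring
  have ha : (piMap^[2 * N] u).a 0 = u.a (2 * N : ℕ) := by rw [iterate_piMap_a, zero_add]
  have hc' : (piMap^[2 * N] u).c = u.c := by simp [iterate_piMap_c]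
  rw [source, ha, hc', iterate_piMap_b, iterate_piMap_q]
  field_simp
  linear_combination (-u.q ^ (2 * N) * u.b : K) * key

lemma iterate_piMap_c_sq (u : Tup N K) (i : ℕ) :
    (u.c⁻¹) ^ (2 * (-1 : ℤ) ^ (i + 1)) = (piMap^[i] u).c ^ 2 := by
  rw [iterate_piMap_c, inv_zpow', pow_succ, ← zpow_natCast, ← zpow_mul]
  congr 1
  push_cast
  ring

/-- In the `(1,…,1)`-periodic reduction with `n = 2N+1`, the time evolution of the higher
order `q`-Painlevé system is `T̂₀ = π^{−(2N+1)}`: writing `π^{2N+1}(u) = (a₀,…,a_{2N}, b',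
c', q, f₁,…,f_{2N})` with `b' = q^{2N+1}·b`, `c' = c⁻¹`, and `u = (a₀,…,a_{2N}, b, c, q,
g₁,…,g_{2N})`, the components satisfy the `2N`-th order system qP⁽²ᴺ⁾(A₄⁽¹⁾),
generalizing the `q`-Painlevé V equation of `A₄⁽¹⁾`-surface type. -/
theorem qP2N_A4_from_pi_pow (hN : 1 ≤ N) (u : Tup N K)
    (hC : (∏ k ∈ range (2 * N + 1), u.a k) = u.q)
    (h : ∀ k ≤ 2 * N + 1, Nz (piMap^[k] u))
    (hden : ∀ i ∈ Icc 1 (2 * N - 1),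
      u.a i ^ (2 * N + 1) - (u.c⁻¹) ^ (2 * (-1 : ℤ) ^ i) * (piMap^[2 * N + 1] u).f i ≠ 0 ∧
      1 - u.a (i + 1 : ℕ) ^ (2 * N + 1) * (u.c⁻¹) ^ (2 * (-1 : ℤ) ^ i) * u.f (i + 1) ≠ 0)
    (hden2 : u.a (2 * N : ℕ) ^ (2 * N + 1)
        - (u.c⁻¹) ^ 2 * (piMap^[2 * N + 1] u).f (2 * N) ≠ 0) :
    (∀ j : ZMod (2 * N + 1), (piMap^[2 * N + 1] u).a j = u.a j) ∧
    (piMap^[2 * N + 1] u).b = u.q ^ (2 * N + 1) * u.b ∧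
    (piMap^[2 * N + 1] u).c = u.c⁻¹ ∧
    (piMap^[2 * N + 1] u).q = u.q ∧
    (∀ i ∈ Icc 1 (2 * N - 1),
      u.a i ^ (2 * N + 1) * (u.f i * (piMap^[2 * N + 1] u).f i - 1)
          / (u.a i ^ (2 * N + 1)
              - (u.c⁻¹) ^ (2 * (-1 : ℤ) ^ i) * (piMap^[2 * N + 1] u).f i)
        = (u.f (i + 1) * (piMap^[2 * N + 1] u).f (i + 1) - 1)
            / (1 - u.a (i + 1 : ℕ) ^ (2 * N + 1)
                  * (u.c⁻¹) ^ (2 * (-1 : ℤ) ^ i) * u.f (i + 1))) ∧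
    u.a (2 * N : ℕ) ^ (2 * N + 1) * (u.f (2 * N) * (piMap^[2 * N + 1] u).f (2 * N) - 1)
        / (u.a (2 * N : ℕ) ^ (2 * N + 1)
            - (u.c⁻¹) ^ 2 * (piMap^[2 * N + 1] u).f (2 * N))
      = (∏ k ∈ Icc 1 (2 * N), u.a k ^ k) * (u.q ^ (2 * N + 1) * u.b) * u.c⁻¹
          / ∏ k ∈ Icc 1 N, (piMap^[2 * N + 1] u).f (2 * k - 1) := by
  have hP : ∀ i, ∏ k ∈ range (2 * N + 1), (piMap^[i] u).a k = (piMap^[i] u).q := fun i => by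
    rw [prod_range_iterate_piMap_a, hC, iterate_piMap_q]
  have step : ∀ i, i + 1 ≤ 2 * N → _ := fun i hi =>
    evolution_step hN (h i (by omega))
      (Function.iterate_succ_apply' piMap i u ▸ h (i + 1) (by omega))
      (Function.iterate_succ_apply' piMap i u ▸
        Function.iterate_succ_apply' piMap (i + 1) u ▸ h (i + 2) (by omega)) (hP i)
  simp only [← Function.iterate_succ_apply'] at step
  have ha : ∀ i, (piMap^[i] u).a 1 = u.a (i + 1 : ℕ) := fun i => by
    rw [iterate_piMap_a, Nat.cast_succ, add_comm]
  have hf : ∀ i, i + 1 ≤ 2 * N → (piMap^[i] u).f 1 = u.f (i + 1) := fun i hi => by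
    rw [iterate_piMap_f u i le_rfl (by omega), add_comm]
  have hc : (piMap^[2 * N + 1] u).c = u.c⁻¹ := by
    rw [iterate_piMap_c, pow_succ, pow_mul]
    simp
  refine ⟨fun j => ?_, iterate_piMap_b u _, hc, iterate_piMap_q u _, fun i hi => ?_, ?_⟩
  · rw [iterate_piMap_a, ZMod.natCast_self, add_zero]
  · obtain ⟨hd₁, hd₂⟩ := hden i hi
    obtain ⟨h₁, h₂⟩ := mem_Icc.mp hi
    obtain ⟨j, rfl⟩ : ∃ j, i = j + 1 := ⟨i - 1, by omega⟩
    have e₁ := (step j (by omega)).1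
    have e₂ := (step (j + 1) (by omega)).2
    have hc₂ : ((piMap^[j + 1] u).c⁻¹) ^ 2 = (piMap^[j] u).c ^ 2 := by
      rw [Function.iterate_succ_apply']
      simp [piMap]
    rw [hc₂] at e₂
    rw [ha, hf _ (by omega), ← iterate_piMap_c_sq,
      ← iterate_piMap_f_eq_Qval hN u (by omega) (by omega)] at e₁ e₂
    exact (e₁ hd₁).trans (e₂ hd₂).symm
  · obtain ⟨j, hj⟩ : ∃ j, 2 * N = j + 1 := ⟨2 * N - 1, by omega⟩
    have e₁ := (step j (by omega)).1
    have hc₁ : (piMap^[j] u).c ^ 2 = (u.c⁻¹) ^ 2 := by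
      rw [← iterate_piMap_c_sq, ← hj]
      simp
    rw [ha, hf _ (by omega), hc₁, Nat.succ_eq_add_one, Nat.succ_eq_add_one, ← hj,
      ← iterate_piMap_f_eq_Qval hN u (by omega) le_rfl,
      source_iterate_two_mul hN (h _ (by omega)) hC] at e₁
    exact e₁ hden2

end QP2NA4
end

section
/- Let λ, α_i, α_j, U, U_i, U_j, U_{ij} be nonzero complex numbers with α_j·U_i − α_i·U_j ≠ 0. For nonzero α, V, W and parameters ν, μ ∈ ℂ define the 2×2 matrix M(α, V, W; ν, μ) = [[μ·W/(α·V), −W^2/ν],[ν/V^2, −μ·W/(α·V)]]. Then the following are equivalent: (1) for every μ ∈ ℂ, M(α_j, U_i, U_{ij}; 1/λ, μ)·M(α_i, U, U_i; λ, μ) = M(α_i, U_j, U_{ij}; 1/λ, μ)·M(α_j, U, U_j; λ, μ); (2) λ^2·U_{ij}/U = (α_i·U_i − α_j·U_j)/(α_j·U_i − α_i·U_j). -/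
namespace LaxLmKdV

/-- The Lax matrix `M(α, V, W; ν, μ) = [[μW/(αV), −W²/ν],[ν/V², −μW/(αV)]]`. -/
noncomputable def Mmat (α V W ν μ : ℂ) : Matrix (Fin 2) (Fin 2) ℂ :=
  !![μ * W / (α * V), -(W ^ 2 / ν); ν / V ^ 2, -(μ * W / (α * V))]

/-- The compatibility, as an identity in the spectral variable `μ`, of the Lax
representation of the paper's lattice system in two lattice directions `i, j` is equivalent
to the equation `λ²·U_{ij}/U = (αᵢUᵢ − αⱼUⱼ)/(αⱼUᵢ − αᵢUⱼ)`. -/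
theorem lax_compat_iff_lmKdV (lm αi αj U Ui Uj Uij : ℂ)
    (hlm : lm ≠ 0) (hαi : αi ≠ 0) (hαj : αj ≠ 0)
    (hU : U ≠ 0) (hUi : Ui ≠ 0) (hUj : Uj ≠ 0) (hUij : Uij ≠ 0)
    (hden : αj * Ui - αi * Uj ≠ 0) :
    (∀ μ : ℂ, Mmat αj Ui Uij (1 / lm) μ * Mmat αi U Ui lm μ
        = Mmat αi Uj Uij (1 / lm) μ * Mmat αj U Uj lm μ)
      ↔ lm ^ 2 * Uij / U = (αi * Ui - αj * Uj) / (αj * Ui - αi * Uj) := by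
  have key : lm ^ 2 * Uij / U = (αi * Ui - αj * Uj) / (αj * Ui - αi * Uj) ↔
      lm ^ 2 * Uij * (αj * Ui - αi * Uj) = (αi * Ui - αj * Uj) * U :=
    div_eq_div_iff hU hden
  rw [key]
  constructor
  · intro h
    have h12 := congrFun (congrFun (h 1) 0) 1
    simp only [Mmat, Matrix.mul_apply, Fin.sum_univ_two, Matrix.of_apply, Matrix.cons_val',
      Matrix.cons_val_zero, Matrix.cons_val_one, Matrix.cons_val_fin_one] at h12
    field_simp at h12
    linear_combination h12
  · intro h μ
    ext a b
    fin_cases a <;> fin_cases b <;>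
      simp only [Mmat, Matrix.mul_apply, Fin.sum_univ_two, Matrix.of_apply, Matrix.cons_val',
        Matrix.cons_val_zero, Matrix.cons_val_one, Matrix.cons_val_fin_one, Fin.zero_eta,
        Fin.mk_one]
    · field_simp
    · field_simp
      linear_combination μ * h
    · field_simp
      linear_combination μ * h
    · field_simp

end LaxLmKdV
end

section
/- Let λ, α_k, κ, U, U_k, U_0, U_{0k} be nonzero complex numbers. For nonzero α, V, W and parameters ν, μ ∈ ℂ define M(α, V, W; ν, μ) = [[μ·W/(α·V), −W^2/ν],[ν/V^2, −μ·W/(α·V)]] and L0(V, W; ν, μ) = [[−μ·κ·W/V, −ν^2·W^2],[1/(ν^2·V^2), 0]]. Then the following are equivalent: (1) for every μ ∈ ℂ, L0(U_k, U_{0k}; 1/λ, μ)·M(α_k, U, U_k; λ, μ) = M(α_k, U_0, U_{0k}; 1/λ, μ)·L0(U, U_0; λ, μ); (2) U_{0k}/U + λ^4·U_0/U_k + α_k·κ·λ = 0. -/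
namespace LaxD4

/-- The Lax matrix `M(α, V, W; ν, μ) = [[μW/(αV), −W²/ν],[ν/V², −μW/(αV)]]`. -/
noncomputable def Mmat (α V W ν μ : ℂ) : Matrix (Fin 2) (Fin 2) ℂ :=
  !![μ * W / (α * V), -(W ^ 2 / ν); ν / V ^ 2, -(μ * W / (α * V))]

/-- The Lax matrix `L0(V, W; ν, μ) = [[−μκW/V, −ν²W²],[1/(ν²V²), 0]]` of the extra
lattice direction `0` (with parameter `κ`). -/
noncomputable def L0mat (κ V W ν μ : ℂ) : Matrix (Fin 2) (Fin 2) ℂ :=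
  !![-(μ * κ * W / V), -(ν ^ 2 * W ^ 2); 1 / (ν ^ 2 * V ^ 2), 0]

/-- The compatibility, as an identity in the spectral variable `μ`, of the Lax
representation of the paper's lattice system in a lattice direction `k` and the extra
direction `0` is equivalent to Boll's D4-type equation
`U_{0k}/U + λ⁴·U₀/U_k + α_k·κ·λ = 0`. -/
theorem lax_compat_iff_D4 (lm αk κ U Uk U0 U0k : ℂ)
    (hlm : lm ≠ 0) (hαk : αk ≠ 0) (hκ : κ ≠ 0)
    (hU : U ≠ 0) (hUk : Uk ≠ 0) (hU0 : U0 ≠ 0) (hU0k : U0k ≠ 0) :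
    (∀ μ : ℂ, L0mat κ Uk U0k (1 / lm) μ * Mmat αk U Uk lm μ
        = Mmat αk U0 U0k (1 / lm) μ * L0mat κ U U0 lm μ)
      ↔ U0k / U + lm ^ 4 * U0 / Uk + αk * κ * lm = 0 := by
  have h_diff : ∀ μ : ℂ, L0mat κ Uk U0k (1 / lm) μ * Mmat αk U Uk lm μ
      - Mmat αk U0 U0k (1 / lm) μ * L0mat κ U U0 lm μ
      = (U0k / U + lm ^ 4 * U0 / Uk + αk * κ * lm) •
        !![0, μ * U0k * Uk / (lm ^ 2 * αk); μ / (αk * U * U0 * lm ^ 2), 0] := by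
    intro μ
    ext i j
    fin_cases i <;> fin_cases j <;>
      simp [L0mat, Mmat] <;> field_simp <;> ring
  constructor
  · intro h
    have h_zero := h_diff 1
    rw [h 1, sub_self] at h_zero
    have h_entry := congrFun (congrFun h_zero 0) 1
    simpa [hlm, hαk, hUk, hU0k] using h_entry
  · intro h μ
    rw [← sub_eq_zero, h_diff μ, h, zero_smul]

end LaxD4
end
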